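/- arXiv:math/0209062 — 4 statements merged into one kernel-verified Lean document; each statement's English description precedes it below -/
import Mathlib

section
/- Let γ be a real number with 0 < γ such that cos γ · cosh γ + 1 = 0 and cos z · cosh z + 1 ≠ 0 for all z with 0 < z < γ (i.e., γ is the smallest positive solution of cos z cosh z + 1 = 0). Then there exists a real constant α > 0 such that the sequence A(2n−1) · γ^{2n} / (2n−1)! converges to α as n → ∞; equivalently, ♯(P_n) = n·A(2n−1) satisfies ♯(P_n) ∼ α · n(2n−1)!/γ^{2n}. -/
/-- A permutation of `{1,…,m}` (encoded as `Fin m`, 0-indexed) is 2up-2down if (in 1-based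
positions) `σ(i) < σ(i+1)` exactly when `i ≡ 1, 2 (mod 4)`; with 0-based index `i`
this reads `σ(i) < σ(i+1) ↔ i % 4 < 2`. -/
def Is2Up2Down {m : ℕ} (σ : Equiv.Perm (Fin m)) : Prop :=
  ∀ i : ℕ, ∀ h : i + 1 < m, (σ ⟨i, by omega⟩ < σ ⟨i + 1, h⟩ ↔ i % 4 < 2)

/-- `A m` is the number of 2up-2down permutations of `{1,…,m}`. -/
noncomputable def numTwoUpTwoDown (m : ℕ) : ℕ :=
  Nat.card {σ : Equiv.Perm (Fin m) // Is2Up2Down σ}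

open Finset intervalIntegral

/-- Refined counts: `lastCount m j` is the number of 2up-2down permutations of `Fin (m + 1)`
whose last value is `j`. -/
noncomputable def lastCount : ℕ → ℕ → ℕ
  | 0, _ => 1
  | m + 1, j => ∑ i ∈ range (m + 1), if (i < j ↔ m % 4 < 2) then lastCount m i else 0

/-- Appends the last value `j` to `τ`, relabelling the other values in order. -/
noncomputable def snocPerm {n : ℕ} (j : Fin (n + 1)) (τ : Equiv.Perm (Fin n)) :
    Equiv.Perm (Fin (n + 1)) :=
  Equiv.ofBijective (Fin.snoc (α := fun _ => Fin (n + 1)) (fun i => j.succAbove (τ i)) j) <| by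
    rw [← Finite.injective_iff_bijective]
    intro a b
    induction a using Fin.lastCases <;> induction b using Fin.lastCases
    · simp
    · intro h
      simp only [Fin.snoc_last, Fin.snoc_castSucc] at h
      exact absurd h.symm (Fin.succAbove_ne _ _)
    · intro h
      simp only [Fin.snoc_last, Fin.snoc_castSucc] at h
      exact absurd h (Fin.succAbove_ne _ _)
    · intro h
      simpa only [Fin.snoc_castSucc, Fin.succAbove_right_inj, τ.injective.eq_iff,
        Fin.castSucc_inj] using h

@[simp] theorem snocPerm_last {n : ℕ} (j : Fin (n + 1)) (τ : Equiv.Perm (Fin n)) :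
    snocPerm j τ (Fin.last n) = j := by
  simp [snocPerm]

@[simp] theorem snocPerm_castSucc {n : ℕ} (j : Fin (n + 1)) (τ : Equiv.Perm (Fin n)) (i : Fin n) :
    snocPerm j τ i.castSucc = j.succAbove (τ i) := by
  simp [snocPerm]

theorem snocPerm_bijective (n : ℕ) :
    Function.Bijective fun p : Fin (n + 1) × Equiv.Perm (Fin n) => snocPerm p.1 p.2 := by
  rw [Fintype.bijective_iff_injective_and_card]
  constructor
  · rintro ⟨j, τ⟩ ⟨j', τ'⟩ h
    have hj : j = j' := by simpa using congrArg (fun σ => σ (Fin.last n)) h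
    subst hj
    refine Prod.ext rfl (Equiv.ext fun i => ?_)
    simpa using congrArg (fun σ => σ i.castSucc) h
  · simp [Fintype.card_perm, Nat.factorial_succ]

theorem is2Up2Down_snocPerm {m : ℕ} (j : Fin (m + 2)) (τ : Equiv.Perm (Fin (m + 1))) :
    Is2Up2Down (snocPerm j τ) ↔
      Is2Up2Down τ ∧ ((τ (Fin.last m) : ℕ) < j ↔ m % 4 < 2) := by
  have key : ∀ i : ℕ, ∀ h : i + 1 < m + 1,
      (snocPerm j τ ⟨i, by omega⟩ < snocPerm j τ ⟨i + 1, by omega⟩ ↔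
        τ ⟨i, by omega⟩ < τ ⟨i + 1, h⟩) := by
    intro i h
    have h1 := snocPerm_castSucc j τ ⟨i, by omega⟩
    have h2 := snocPerm_castSucc j τ ⟨i + 1, h⟩
    simp only [Fin.castSucc_mk] at h1 h2
    rw [h1, h2, Fin.succAbove_lt_succAbove_iff]
  have keyLast : (snocPerm j τ ⟨m, by omega⟩ < snocPerm j τ ⟨m + 1, by omega⟩ ↔
      (τ (Fin.last m) : ℕ) < j) := by
    have h1 := snocPerm_castSucc j τ (Fin.last m)
    have h2 := snocPerm_last j τ
    have e1 : (Fin.last m).castSucc = (⟨m, by omega⟩ : Fin (m + 2)) := rfl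
    have e2 : Fin.last (m + 1) = (⟨m + 1, by omega⟩ : Fin (m + 2)) := rfl
    rw [e1] at h1
    rw [e2] at h2
    rw [h1, h2, Fin.succAbove_lt_iff_castSucc_lt, Fin.lt_def, Fin.val_castSucc]
  constructor
  · intro h
    exact ⟨fun i hi => (key i hi).symm.trans (h i (by omega)),
      keyLast.symm.trans (h m (by omega))⟩
  · rintro ⟨h1, h2⟩ i hi
    rcases Nat.lt_or_ge i m with him | him
    · exact (key i (by omega)).trans (h1 i (by omega))
    · obtain rfl : i = m := by omega
      exact keyLast.trans h2

open Classical in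
theorem sum_is2Up2Down (m : ℕ) (w : ℕ → ℕ) :
    (∑ τ : Equiv.Perm (Fin (m + 1)), if Is2Up2Down τ then w (τ (Fin.last m)) else 0) =
      ∑ j ∈ range (m + 1), lastCount m j * w j := by
  induction m generalizing w with
  | zero =>
    have h : ∀ τ : Equiv.Perm (Fin 1), Is2Up2Down τ := fun τ i hi => by omega
    simp [h, lastCount]
  | succ m ih =>
    rw [← (snocPerm_bijective (m + 1)).sum_comp, Fintype.sum_prod_type, Finset.sum_comm]
    let v : ℕ → ℕ := fun i => ∑ j ∈ range (m + 2), if (i < j ↔ m % 4 < 2) then w j else 0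
    have h : ∀ τ : Equiv.Perm (Fin (m + 1)),
        (∑ j : Fin (m + 2), if Is2Up2Down (snocPerm j τ) then
          w (snocPerm j τ (Fin.last (m + 1))) else 0) =
        if Is2Up2Down τ then v (τ (Fin.last m)) else 0 := by
      intro τ
      simp only [is2Up2Down_snocPerm, snocPerm_last]
      by_cases hτ : Is2Up2Down τ
      · simp only [hτ, true_and, if_true, v]
        rw [← Fin.sum_univ_eq_sum_range
          (fun j => if ((τ (Fin.last m) : ℕ) < j ↔ m % 4 < 2) then w j else 0) (m + 2)]
      · simp [hτ]
    refine (Finset.sum_congr rfl fun τ _ => h τ).trans ((ih v).trans ?_)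
    simp only [v, lastCount, Finset.mul_sum, Finset.sum_mul]
    rw [Finset.sum_comm]
    refine Finset.sum_congr rfl fun j _ => Finset.sum_congr rfl fun i _ => ?_
    split_ifs <;> simp

theorem numTwoUpTwoDown_succ (m : ℕ) :
    numTwoUpTwoDown (m + 1) = ∑ j ∈ range (m + 1), lastCount m j := by
  classical
  have h := sum_is2Up2Down m fun _ => 1
  simp only [mul_one] at h
  rw [← h, numTwoUpTwoDown, Nat.card_eq_fintype_card, Fintype.card_subtype, Finset.card_filter]

/-- Polynomials in a rescaled Bernstein basis. -/
noncomputable def bernsteinSum (c : ℕ → ℝ) (m : ℕ) (x : ℝ) : ℝ :=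
  ∑ j ∈ range (m + 1), c j * (x ^ j / j.factorial * ((1 - x) ^ (m - j) / (m - j).factorial))

theorem hasDerivAt_pow_succ_div_factorial (n : ℕ) (x : ℝ) :
    HasDerivAt (fun x : ℝ => x ^ (n + 1) / (n + 1).factorial) (x ^ n / n.factorial) x := by
  refine ((hasDerivAt_pow (n + 1) x).div_const ((n + 1).factorial : ℝ)).congr_deriv ?_
  rw [Nat.factorial_succ]
  push_cast
  have : (n.factorial : ℝ) ≠ 0 := by positivity
  field_simp

theorem hasDerivAt_bernsteinSum (c : ℕ → ℝ) (m : ℕ) (x : ℝ) :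
    HasDerivAt (bernsteinSum c (m + 1)) (bernsteinSum (fun j => c (j + 1) - c j) m x) x := by
  have hsum : bernsteinSum (fun j => c (j + 1) - c j) m x =
      (∑ j ∈ range (m + 1),
        c (j + 1) * (x ^ j / j.factorial * ((1 - x) ^ (m - j) / (m - j).factorial))) -
      ∑ j ∈ range (m + 1),
        c j * (x ^ j / j.factorial * ((1 - x) ^ (m - j) / (m - j).factorial)) := by
    simp only [bernsteinSum, sub_mul, Finset.sum_sub_distrib]
  let p : ℕ → ℝ → ℝ := fun n x => x ^ n / n.factorial
  let p' : ℕ → ℝ → ℝ := fun n x => if n = 0 then 0 else x ^ (n - 1) / (n - 1).factorial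
  have hp : ∀ n y, HasDerivAt (p n) (p' n y) y := by
    rintro (_ | n) y
    · simpa [p, p'] using hasDerivAt_const y (1 : ℝ)
    · simpa [p, p'] using hasDerivAt_pow_succ_div_factorial n y
  have hq : ∀ n, HasDerivAt (fun y => p n (1 - y)) (-p' n (1 - x)) x := by
    intro n
    exact (hp n (1 - x)).comp_const_sub 1 x
  have hd : HasDerivAt (bernsteinSum c (m + 1))
      (∑ j ∈ range (m + 2),
        c j * (p' j x * p (m + 1 - j) (1 - x) + p j x * -p' (m + 1 - j) (1 - x))) x :=
    HasDerivAt.fun_sum fun j _ => ((hp j x).mul (hq (m + 1 - j))).const_mul (c j)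
  refine hd.congr_deriv ?_
  rw [hsum]
  simp only [mul_add, Finset.sum_add_distrib]
  rw [Finset.sum_range_succ' (fun j => c j * (p' j x * p (m + 1 - j) (1 - x))),
    Finset.sum_range_succ (fun j => c j * (p j x * -p' (m + 1 - j) (1 - x))),
    sub_eq_add_neg (Finset.sum _ _), ← Finset.sum_neg_distrib]
  congr 1
  · simp [p, p']
  · simp only [p, p', Nat.sub_self, if_true, neg_zero, mul_zero, add_zero]
    refine Finset.sum_congr rfl fun j hj => ?_
    have hj' : j ≤ m := by simpa [Nat.lt_succ_iff] using hj
    have h1 : m + 1 - j ≠ 0 := by omega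
    have h2 : m + 1 - j - 1 = m - j := by omega
    rw [if_neg h1, h2]
    ring

theorem continuous_bernsteinSum (c : ℕ → ℝ) (m : ℕ) : Continuous (bernsteinSum c m) := by
  unfold bernsteinSum
  fun_prop

theorem bernsteinSum_zero (c : ℕ → ℝ) (m : ℕ) : bernsteinSum c m 0 = c 0 / m.factorial := by
  rw [bernsteinSum, Finset.sum_eq_single 0]
  · simp [div_eq_mul_inv]
  · intro j _ hj
    simp [hj]
  · simp

theorem bernsteinSum_one (c : ℕ → ℝ) (m : ℕ) : bernsteinSum c m 1 = c m / m.factorial := by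
  rw [bernsteinSum, Finset.sum_eq_single m]
  · simp [div_eq_mul_inv]
  · intro j hj hjm
    have : m - j ≠ 0 := by
      have := Finset.mem_range.mp hj
      omega
    simp [this]
  · simp

theorem bernsteinSum_congr {c d : ℕ → ℝ} {m : ℕ} (h : ∀ j ≤ m, c j = d j) :
    bernsteinSum c m = bernsteinSum d m := by
  funext x
  refine Finset.sum_congr rfl fun j hj => ?_
  rw [h j (Nat.lt_succ_iff.mp (Finset.mem_range.mp hj))]

theorem integral_bernsteinSum (c : ℕ → ℝ) (m : ℕ) :
    ∫ x in (0 : ℝ)..1, bernsteinSum c m x =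
      (∑ j ∈ range (m + 1), c j) / (m + 1).factorial := by
  have h : ∀ x, HasDerivAt (bernsteinSum (fun j => ∑ i ∈ range j, c i) (m + 1))
      (bernsteinSum c m x) x := by
    intro x
    refine (hasDerivAt_bernsteinSum (fun j => ∑ i ∈ range j, c i) m x).congr_deriv ?_
    simp [Finset.sum_range_succ]
  rw [integral_eq_sub_of_hasDerivAt (fun x _ => h x)
    ((continuous_bernsteinSum c m).intervalIntegrable _ _), bernsteinSum_one, bernsteinSum_zero]
  simp

/-- The density of the last entry of a random pattern of length `m + 1`. -/
noncomputable def lastDensity (m : ℕ) : ℝ → ℝ := bernsteinSum (fun j => lastCount m j) m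

theorem integral_lastDensity (m : ℕ) :
    ∫ x in (0 : ℝ)..1, lastDensity m x = numTwoUpTwoDown (m + 1) / (m + 1).factorial := by
  rw [lastDensity, integral_bernsteinSum, numTwoUpTwoDown_succ]
  push_cast
  rfl

theorem hasDerivAt_lastDensity_of_up {m : ℕ} (hm : m % 4 < 2) (x : ℝ) :
    HasDerivAt (lastDensity (m + 1)) (lastDensity m x) x := by
  refine (hasDerivAt_bernsteinSum (fun j => (lastCount (m + 1) j : ℝ)) m x).congr_deriv ?_
  refine congrFun (bernsteinSum_congr fun j hj => ?_) x
  have hs : ∀ k ≤ m + 1, lastCount (m + 1) k = ∑ i ∈ range k, lastCount m i := by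
    intro k hk
    simp only [lastCount, hm, iff_true]
    rw [← Finset.sum_filter]
    congr 1
    ext i
    simp only [Finset.mem_filter, Finset.mem_range]
    omega
  rw [hs j (by omega), hs (j + 1) (by omega), Finset.sum_range_succ]
  push_cast
  ring

theorem hasDerivAt_lastDensity_of_down {m : ℕ} (hm : ¬ m % 4 < 2) (x : ℝ) :
    HasDerivAt (lastDensity (m + 1)) (-lastDensity m x) x := by
  refine (hasDerivAt_bernsteinSum (fun j => (lastCount (m + 1) j : ℝ)) m x).congr_deriv ?_
  have hneg : -lastDensity m x = bernsteinSum (fun j => -(lastCount m j : ℝ)) m x := by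
    simp [lastDensity, bernsteinSum]
  rw [hneg]
  refine congrFun (bernsteinSum_congr fun j hj => ?_) x
  have hs : ∀ k ≤ m + 1, lastCount (m + 1) k = ∑ i ∈ Finset.Ico k (m + 1), lastCount m i := by
    intro k hk
    simp only [lastCount, hm, iff_false]
    rw [← Finset.sum_filter]
    congr 1
    ext i
    simp only [Finset.mem_filter, Finset.mem_range, Finset.mem_Ico]
    omega
  rw [hs j (by omega), hs (j + 1) (by omega),
    Finset.sum_eq_sum_Ico_succ_bot (show j < m + 1 by omega)]
  push_cast
  ring

theorem lastDensity_succ_zero_of_up {m : ℕ} (hm : m % 4 < 2) : lastDensity (m + 1) 0 = 0 := by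
  rw [lastDensity, bernsteinSum_zero]
  simp [lastCount, hm]

theorem lastDensity_succ_one_of_down {m : ℕ} (hm : ¬ m % 4 < 2) : lastDensity (m + 1) 1 = 0 := by
  rw [lastDensity, bernsteinSum_one]
  have : lastCount (m + 1) (m + 1) = 0 := by
    simp only [lastCount, hm, iff_false]
    refine Finset.sum_eq_zero fun i hi => ?_
    rw [if_neg (not_not.mpr (Finset.mem_range.mp hi))]
  simp [this]

theorem lastDensity_zero : lastDensity 0 = fun _ => 1 := by
  funext x
  simp [lastDensity, bernsteinSum, lastCount]

/-- The reflected second iterated integral `f ↦ (x ↦ ∫ t in 0..1-x, (1 - x - t) f t)`. -/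
noncomputable def reflInt (f : ℝ → ℝ) (x : ℝ) : ℝ := ∫ t in (0 : ℝ)..(1 - x), (1 - x - t) * f t

theorem integral_mul_of_hasDerivAt {F G f : ℝ → ℝ} (hF : ∀ x, HasDerivAt F (G x) x)
    (hG : ∀ x, HasDerivAt G (f x) x) (hf : Continuous f) (hF0 : F 0 = 0) (hG0 : G 0 = 0) (y : ℝ) :
    ∫ t in (0 : ℝ)..y, (y - t) * f t = F y := by
  have h : ∀ t, HasDerivAt (fun t => (y - t) * G t + F t) ((y - t) * f t) t := by
    intro t
    have := (((hasDerivAt_id t).const_sub y).mul (hG t)).add (hF t)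
    refine this.congr_deriv ?_
    simp
  rw [integral_eq_sub_of_hasDerivAt (fun t _ => h t)
    (Continuous.intervalIntegrable (by fun_prop) _ _)]
  simp [hF0, hG0]

theorem iterate_reflInt_one (n : ℕ) :
    reflInt^[n] (fun _ => 1) =
      fun x => lastDensity (2 * n) (if n % 2 = 0 then x else 1 - x) := by
  induction n with
  | zero => simp [lastDensity_zero]
  | succ n ih =>
    rw [Function.iterate_succ_apply', ih]
    funext x
    rcases Nat.mod_two_eq_zero_or_one n with hn | hn
    · have hn' : (n + 1) % 2 ≠ 0 := by omega
      simp only [hn, hn', if_true, if_false]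
      exact integral_mul_of_hasDerivAt
        (hasDerivAt_lastDensity_of_up (m := 2 * n + 1) (by omega))
        (hasDerivAt_lastDensity_of_up (m := 2 * n) (by omega)) (continuous_bernsteinSum _ _)
        (lastDensity_succ_zero_of_up (by omega)) (lastDensity_succ_zero_of_up (by omega)) _
    · have hn1 : ¬ n % 2 = 0 := by omega
      have hn' : (n + 1) % 2 = 0 := by omega
      simp only [hn1, hn', if_true, if_false]
      have h1 : ∀ y, HasDerivAt (fun y => lastDensity (2 * n + 2) (1 - y))
          (lastDensity (2 * n + 1) (1 - y)) y := fun y => by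
        simpa using (hasDerivAt_lastDensity_of_down (m := 2 * n + 1)
          (by omega) (1 - y)).comp_const_sub 1 y
      have h2 : ∀ y, HasDerivAt (fun y => lastDensity (2 * n + 1) (1 - y))
          (lastDensity (2 * n) (1 - y)) y := fun y => by
        simpa using (hasDerivAt_lastDensity_of_down (m := 2 * n)
          (by omega) (1 - y)).comp_const_sub 1 y
      have h := integral_mul_of_hasDerivAt h1 h2
        ((continuous_bernsteinSum _ _).comp (continuous_const.sub continuous_id))
        (by simpa using lastDensity_succ_one_of_down (m := 2 * n + 1) (by omega))
        (by simpa using lastDensity_succ_one_of_down (m := 2 * n) (by omega)) (1 - x)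
      rw [reflInt, h, sub_sub_cancel]
      rfl

theorem integral_iterate_reflInt_one (n : ℕ) :
    ∫ x in (0 : ℝ)..1, reflInt^[n] (fun _ => 1) x =
      numTwoUpTwoDown (2 * n + 1) / (2 * n + 1).factorial := by
  rw [iterate_reflInt_one, ← integral_lastDensity]
  split_ifs
  · rfl
  · simp

theorem continuous_reflInt {f : ℝ → ℝ} (hf : Continuous f) : Continuous (reflInt f) :=
  continuous_parametric_intervalIntegral_of_continuous (μ := MeasureTheory.volume)
    (f := fun x t => (1 - x - t) * f t) (by fun_prop) (by fun_prop)

theorem reflInt_const_mul (c : ℝ) (f : ℝ → ℝ) (x : ℝ) :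
    reflInt (fun t => c * f t) x = c * reflInt f x := by
  simp only [reflInt, ← integral_const_mul]
  congr 1
  funext t
  ring

theorem reflInt_sub {f g : ℝ → ℝ} (hf : Continuous f) (hg : Continuous g) (x : ℝ) :
    reflInt (fun t => f t - g t) x = reflInt f x - reflInt g x := by
  simp only [reflInt, mul_sub]
  exact integral_sub (Continuous.intervalIntegrable (by fun_prop) _ _)
    (Continuous.intervalIntegrable (by fun_prop) _ _)

theorem reflInt_mono {f g : ℝ → ℝ} (hf : Continuous f) (hg : Continuous g) {x : ℝ} (hx : x ≤ 1)
    (h : ∀ t, 0 ≤ t → t ≤ 1 - x → f t ≤ g t) : reflInt f x ≤ reflInt g x :=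
  integral_mono_on (by linarith) (Continuous.intervalIntegrable (by fun_prop) _ _)
    (Continuous.intervalIntegrable (by fun_prop) _ _)
    fun t ht => mul_le_mul_of_nonneg_left (h t ht.1 ht.2) (by linarith [ht.2])

theorem reflInt_const (c x : ℝ) : reflInt (fun _ => c) x = c * ((1 - x) ^ 2 / 2) := by
  refine integral_mul_of_hasDerivAt (F := fun y => c * (y ^ 2 / 2)) (G := fun y => c * y)
    (fun y => ?_) (fun y => ?_) continuous_const (by simp) (by simp) (1 - x)
  · refine (((hasDerivAt_pow 2 y).div_const 2).const_mul c).congr_deriv ?_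
    simp
  · simpa using (hasDerivAt_id y).const_mul c

theorem reflInt_nonneg {f : ℝ → ℝ} {x : ℝ} (hx : x ≤ 1)
    (h : ∀ t, 0 ≤ t → t ≤ 1 - x → 0 ≤ f t) : 0 ≤ reflInt f x :=
  integral_nonneg (by linarith) fun t ht => mul_nonneg (by linarith [ht.2]) (h t ht.1 ht.2)

theorem reflInt_half_le {f : ℝ → ℝ} (hf : Continuous f) (h : ∀ t, 0 ≤ t → t ≤ 1 → 0 ≤ f t)
    {x : ℝ} (hx0 : 0 ≤ x) (hx : x ≤ 1 / 2) : reflInt f (1 / 2) ≤ reflInt f x := by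
  have hi : ∀ a b c : ℝ, IntervalIntegrable (fun t => (1 - c - t) * f t) MeasureTheory.volume a b :=
    fun a b c => Continuous.intervalIntegrable (by fun_prop) _ _
  have h1 : reflInt f (1 / 2) ≤ ∫ t in (0 : ℝ)..(1 - 1 / 2), (1 - x - t) * f t :=
    integral_mono_on (by norm_num) (hi _ _ _) (hi _ _ _) fun t ht =>
      mul_le_mul_of_nonneg_right (by linarith) (h t ht.1 (by linarith [ht.2]))
  have h2 : 0 ≤ ∫ t in (1 - 1 / 2 : ℝ)..(1 - x), (1 - x - t) * f t :=
    integral_nonneg (by linarith) fun t ht =>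
      mul_nonneg (by linarith [ht.2]) (h t (by linarith [ht.1]) (by linarith [ht.2]))
  have h3 := integral_add_adjacent_intervals (hi 0 (1 - 1 / 2) x) (hi (1 - 1 / 2) (1 - x) x)
  rw [reflInt.eq_def f x]
  linarith

theorem le_reflInt_reflInt {f : ℝ → ℝ} (hf : Continuous f) (h : ∀ t, 0 ≤ t → t ≤ 1 → 0 ≤ f t)
    {x : ℝ} (hx0 : 0 ≤ x) (hx : x ≤ 1) :
    3 / 8 * (1 - x) ^ 2 * reflInt f (1 / 2) ≤ reflInt (reflInt f) x := by
  have hc := continuous_reflInt hf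
  have hi : ∀ a b : ℝ,
      IntervalIntegrable (fun t => (1 - x - t) * reflInt f t) MeasureTheory.volume a b :=
    fun a b => Continuous.intervalIntegrable (by fun_prop) _ _
  have hconst : ∫ t in (0 : ℝ)..((1 - x) / 2), (1 - x - t) * reflInt f (1 / 2) =
      3 / 8 * (1 - x) ^ 2 * reflInt f (1 / 2) := by
    rw [integral_mul_const, integral_sub (by simp) (by simp), integral_id, integral_const]
    simp only [smul_eq_mul]
    ring
  have h1 : ∫ t in (0 : ℝ)..((1 - x) / 2), (1 - x - t) * reflInt f (1 / 2) ≤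
      ∫ t in (0 : ℝ)..((1 - x) / 2), (1 - x - t) * reflInt f t :=
    integral_mono_on (by linarith) (Continuous.intervalIntegrable (by fun_prop) _ _) (hi _ _)
      fun t ht => mul_le_mul_of_nonneg_left
        (reflInt_half_le hf h ht.1 (by linarith [ht.2])) (by linarith [ht.2])
  have h2 : 0 ≤ ∫ t in ((1 - x) / 2)..(1 - x), (1 - x - t) * reflInt f t :=
    integral_nonneg (by linarith) fun t ht => mul_nonneg (by linarith [ht.2])
      (reflInt_nonneg (by linarith [ht.2]) fun s hs0 hs => h s hs0 (by linarith [ht.1]))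
  have h3 := integral_add_adjacent_intervals (hi 0 ((1 - x) / 2)) (hi ((1 - x) / 2) (1 - x))
  rw [reflInt.eq_def (reflInt f) x]
  linarith

/-- Comparison of `f` with multiples of `φ` on the unit interval. -/
def Sandwich (φ f : ℝ → ℝ) (m M : ℝ) : Prop :=
  ∀ x, 0 ≤ x → x ≤ 1 → m * φ x ≤ f x ∧ f x ≤ M * φ x

theorem Sandwich.step {φ f : ℝ → ℝ} {l m M : ℝ} (hl : 0 ≤ l) (hφ : Continuous φ)
    (hf : Continuous f) (heig : ∀ x, l * reflInt φ x = φ x) (h : Sandwich φ f m M) :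
    Sandwich φ (fun x => l * reflInt f x) m M := by
  intro x hx0 hx
  have h1 : m * reflInt φ x ≤ reflInt f x := by
    rw [← reflInt_const_mul]
    exact reflInt_mono (by fun_prop) hf hx fun t ht0 ht => (h t ht0 (by linarith)).1
  have h2 : reflInt f x ≤ M * reflInt φ x := by
    rw [← reflInt_const_mul]
    exact reflInt_mono hf (by fun_prop) hx fun t ht0 ht => (h t ht0 (by linarith)).2
  rw [← heig x]
  constructor
  · linarith [mul_le_mul_of_nonneg_left h1 hl]
  · linarith [mul_le_mul_of_nonneg_left h2 hl]

theorem le_reflInt_reflInt_sub {φ f g : ℝ → ℝ} {l C : ℝ} (hl : 0 < l) (hC : 0 < C)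
    (hf : Continuous f) (hg : Continuous g)
    (hupper : ∀ x, 0 ≤ x → x ≤ 1 → φ x ≤ C * (1 - x) ^ 2)
    (h : ∀ t, 0 ≤ t → t ≤ 1 → g t ≤ f t) {x : ℝ} (hx0 : 0 ≤ x) (hx : x ≤ 1) :
    l ^ 2 * (3 / (8 * C)) * (reflInt f (1 / 2) - reflInt g (1 / 2)) * φ x ≤
      l ^ 2 * (reflInt (reflInt f) x - reflInt (reflInt g) x) := by
  have h1 := le_reflInt_reflInt (f := fun t => f t - g t) (by fun_prop)
    (fun t ht0 ht => sub_nonneg.mpr (h t ht0 ht)) hx0 hx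
  have hsub : reflInt (fun t => f t - g t) = fun t => reflInt f t - reflInt g t :=
    funext (reflInt_sub hf hg)
  have h0 : 0 ≤ reflInt (fun t => f t - g t) (1 / 2) :=
    reflInt_nonneg (by norm_num) fun t ht0 ht => sub_nonneg.mpr (h t ht0 (by linarith))
  rw [hsub] at h1 h0
  rw [reflInt_sub (continuous_reflInt hf) (continuous_reflInt hg)] at h1
  set d := reflInt f (1 / 2) - reflInt g (1 / 2)
  have h2 : 3 / (8 * C) * d * φ x ≤ 3 / 8 * (1 - x) ^ 2 * d := by
    calc 3 / (8 * C) * d * φ x ≤ 3 / (8 * C) * d * (C * (1 - x) ^ 2) :=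
          mul_le_mul_of_nonneg_left (hupper x hx0 hx) (by positivity)
      _ = 3 / 8 * (1 - x) ^ 2 * d := by field_simp
  calc l ^ 2 * (3 / (8 * C)) * d * φ x = l ^ 2 * (3 / (8 * C) * d * φ x) := by ring
    _ ≤ _ := mul_le_mul_of_nonneg_left (h2.trans h1) (by positivity)

theorem Sandwich.contract {φ f : ℝ → ℝ} {l C m M : ℝ} (hl : 0 < l) (hC : 0 < C)
    (hφ : Continuous φ) (hf : Continuous f) (heig : ∀ x, l * reflInt φ x = φ x)
    (hupper : ∀ x, 0 ≤ x → x ≤ 1 → φ x ≤ C * (1 - x) ^ 2) (h : Sandwich φ f m M) :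
    ∃ m' M', m ≤ m' ∧
      M' - m' = (1 - l ^ 2 * (3 / (8 * C)) * reflInt φ (1 / 2)) * (M - m) ∧
      Sandwich φ (fun x => l * reflInt (fun t => l * reflInt f t) x) m' M' := by
  set κ := l ^ 2 * (3 / (8 * C)) with hκ
  set a := reflInt f (1 / 2) with ha
  set b := reflInt φ (1 / 2) with hb
  have hκ0 : 0 ≤ κ := by positivity
  have hm : m * b ≤ a := by
    rw [ha, hb, ← reflInt_const_mul]
    exact reflInt_mono (by fun_prop) hf (by norm_num) fun t ht0 ht => (h t ht0 (by linarith)).1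
  have hcm : ∀ c : ℝ, reflInt (fun t => c * φ t) = fun t => c * reflInt φ t :=
    fun c => funext (reflInt_const_mul c φ)
  have heig2 : ∀ x, l ^ 2 * reflInt (reflInt φ) x = φ x := by
    intro x
    have : (fun t => l * reflInt φ t) = φ := funext heig
    rw [pow_two, mul_assoc, ← reflInt_const_mul, this, heig]
  refine ⟨m + κ * (a - m * b), M - κ * (M * b - a), ?_, by ring, fun x hx0 hx => ?_⟩
  · have := mul_nonneg hκ0 (sub_nonneg.mpr hm)
    linarith
  · have h1 := le_reflInt_reflInt_sub (φ := φ) (g := fun t => m * φ t) hl hC hf (by fun_prop) hupper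
      (fun t ht0 ht => (h t ht0 ht).1) hx0 hx
    have h2 := le_reflInt_reflInt_sub (φ := φ) (f := fun t => M * φ t) hl hC (by fun_prop) hf hupper
      (fun t ht0 ht => (h t ht0 ht).2) hx0 hx
    simp only [hcm, reflInt_const_mul] at h1 h2 ⊢
    rw [← hκ, ← ha, ← hb] at h1 h2
    have e := heig2 x
    constructor
    · linear_combination h1 - m * e
    · linear_combination h2 + M * e

theorem exists_tendsto_pow_mul_integral_iterate_reflInt {φ : ℝ → ℝ} {l c C : ℝ} (hl : 0 < l)
    (hc : 0 < c) (hC : 0 < C) (hφ : Continuous φ) (heig : ∀ x, l * reflInt φ x = φ x)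
    (hlower : ∀ x, 0 ≤ x → x ≤ 1 → c * (1 - x) ^ 2 ≤ φ x)
    (hupper : ∀ x, 0 ≤ x → x ≤ 1 → φ x ≤ C * (1 - x) ^ 2) :
    ∃ α : ℝ, 0 < α ∧ Filter.Tendsto
      (fun n : ℕ => l ^ n * ∫ x in (0 : ℝ)..1, reflInt^[n] (fun _ => 1) x)
      Filter.atTop (nhds α) := by
  let f : ℕ → ℝ → ℝ := fun n x => l ^ n * reflInt^[n] (fun _ => 1) x
  have hiter : ∀ n, Continuous (reflInt^[n] fun _ => 1) := by
    intro n
    induction n with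
    | zero => exact continuous_const
    | succ n ih =>
      rw [Function.iterate_succ_apply']
      exact continuous_reflInt ih
  have hf : ∀ n, Continuous (f n) := fun n => continuous_const.mul (hiter n)
  have hsucc : ∀ n, f (n + 1) = fun x => l * reflInt (f n) x := by
    intro n
    funext x
    simp only [f, reflInt_const_mul, Function.iterate_succ_apply', pow_succ]
    ring
  have hpos : ∀ x, 0 ≤ x → x < 1 → 0 < φ x := fun x hx0 hx =>
    lt_of_lt_of_le (mul_pos hc (pow_pos (by linarith) 2)) (hlower x hx0 hx.le)
  have hmono : ∀ {N m M}, Sandwich φ (f N) m M → ∀ n, N ≤ n → Sandwich φ (f n) m M := by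
    intro N m M h n hn
    induction n, hn using Nat.le_induction with
    | base => exact h
    | succ n _ ih =>
      rw [hsucc]
      exact ih.step hl.le hφ (hf n) heig
  set r := 1 - l ^ 2 * (3 / (8 * C)) * reflInt φ (1 / 2) with hr
  have hb : 0 < reflInt φ (1 / 2) := by
    have := hpos (1 / 2) (by norm_num) (by norm_num)
    rw [← heig] at this
    exact pos_of_mul_pos_right this hl.le
  have hr1 : r < 1 := by
    have : 0 < l ^ 2 * (3 / (8 * C)) * reflInt φ (1 / 2) := by positivity
    linarith
  have hr0 : 0 ≤ r := by
    have h0 := le_reflInt_reflInt_sub (φ := φ) (f := φ) (g := fun _ => 0) (x := 0) hl hC hφ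
      continuous_const hupper (fun t ht0 ht => le_trans (by positivity) (hlower t ht0 ht))
      le_rfl zero_le_one
    have hz : reflInt (fun _ => 0) = fun _ => 0 := by
      funext x
      simp [reflInt_const]
    have hφ' : (fun t => l * reflInt φ t) = φ := funext heig
    have e : l ^ 2 * reflInt (reflInt φ) 0 = φ 0 := by
      rw [pow_two, mul_assoc, ← reflInt_const_mul, hφ', heig]
    simp only [hz, sub_zero] at h0
    rw [e] at h0
    have := hpos 0 le_rfl one_pos
    rw [hr]
    nlinarith
  obtain ⟨m₀, M₀, hm₀, hM₀, h₀⟩ : ∃ m M, 0 < m ∧ m ≤ M ∧ Sandwich φ (f 1) m M := by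
    have hcC : c ≤ C := by
      have := (hlower 0 le_rfl zero_le_one).trans (hupper 0 le_rfl zero_le_one)
      simpa using this
    refine ⟨l / (2 * C), l / (2 * c), by positivity, by gcongr, fun x hx0 hx => ?_⟩
    have h1 : f 1 x = l * ((1 - x) ^ 2 / 2) := by simp [f, reflInt_const]
    rw [h1]
    constructor
    · calc l / (2 * C) * φ x ≤ l / (2 * C) * (C * (1 - x) ^ 2) :=
            mul_le_mul_of_nonneg_left (hupper x hx0 hx) (by positivity)
        _ = _ := by field_simp
    · calc l * ((1 - x) ^ 2 / 2) = l / (2 * c) * (c * (1 - x) ^ 2) := by field_simp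
        _ ≤ _ := mul_le_mul_of_nonneg_left (hlower x hx0 hx) (by positivity)
  have hseq : ∀ k : ℕ, ∃ m M, m₀ ≤ m ∧ M - m = r ^ k * (M₀ - m₀) ∧
      Sandwich φ (f (2 * k + 1)) m M := by
    intro k
    induction k with
    | zero => exact ⟨m₀, M₀, le_rfl, by simp, h₀⟩
    | succ k ih =>
      obtain ⟨m, M, hm, hM, h⟩ := ih
      obtain ⟨m', M', hm', hM', h'⟩ := h.contract hl hC hφ (hf _) heig hupper
      refine ⟨m', M', hm.trans hm', by rw [hM', hM, pow_succ]; ring, ?_⟩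
      rw [show 2 * (k + 1) + 1 = 2 * k + 1 + 1 + 1 by ring, hsucc, hsucc]
      exact h'
  set I := ∫ x in (0 : ℝ)..1, φ x
  have hI : 0 < I := intervalIntegral_pos_of_pos_on (hφ.intervalIntegrable _ _)
    (fun x hx => hpos x hx.1.le hx.2) one_pos
  have hint : ∀ {n m M}, Sandwich φ (f n) m M →
      m * I ≤ (∫ x in (0 : ℝ)..1, f n x) ∧ (∫ x in (0 : ℝ)..1, f n x) ≤ M * I := by
    intro n m M h
    simp only [I, ← integral_const_mul]
    exact ⟨integral_mono_on zero_le_one ((hφ.const_mul m).intervalIntegrable _ _)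
        ((hf n).intervalIntegrable _ _) fun x hx => (h x hx.1 hx.2).1,
      integral_mono_on zero_le_one ((hf n).intervalIntegrable _ _)
        ((hφ.const_mul M).intervalIntegrable _ _) fun x hx => (h x hx.1 hx.2).2⟩
  have hcauchy : CauchySeq fun n => ∫ x in (0 : ℝ)..1, f n x := by
    rw [Metric.cauchySeq_iff']
    intro ε hε
    have hlim : Filter.Tendsto (fun k : ℕ => r ^ k * (M₀ - m₀) * I) Filter.atTop (nhds 0) := by
      simpa using ((tendsto_pow_atTop_nhds_zero_of_lt_one hr0 hr1).mul_const (M₀ - m₀)).mul_const I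
    obtain ⟨k, hk⟩ := (hlim.eventually_lt_const hε).exists
    obtain ⟨m, M, -, hM, h⟩ := hseq k
    refine ⟨2 * k + 1, fun n hn => ?_⟩
    obtain ⟨h1, h2⟩ := hint h
    obtain ⟨h3, h4⟩ := hint (hmono h n hn)
    rw [← hM, sub_mul] at hk
    rw [Real.dist_eq, abs_lt]
    constructor <;> linarith
  obtain ⟨α, hα⟩ := cauchySeq_tendsto_of_complete hcauchy
  refine ⟨α, lt_of_lt_of_le (mul_pos hm₀ hI) (ge_of_tendsto hα ?_), ?_⟩
  · filter_upwards [Filter.eventually_ge_atTop 1] with n hn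
    exact (hint (hmono h₀ n hn)).1
  · simpa only [f, integral_const_mul] using hα

/-- The reflected fundamental mode of a clamped-free beam. -/
noncomputable def beamMode (γ x : ℝ) : ℝ :=
  Real.cosh (γ * (x - 1 / 2)) / Real.cosh (γ / 2) - Real.sin (γ * (x - 1 / 2)) / Real.sin (γ / 2)

theorem continuous_beamMode (γ : ℝ) : Continuous (beamMode γ) := by
  unfold beamMode
  fun_prop

theorem lt_pi_of_minimal {γ : ℝ}
    (hγmin : ∀ z : ℝ, 0 < z → z < γ → Real.cos z * Real.cosh z + 1 ≠ 0) : γ < Real.pi := by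
  by_contra! hπ
  have hcont : ContinuousOn (fun z => Real.cos z * Real.cosh z + 1) (Set.Icc 0 Real.pi) := by
    fun_prop
  have h0 : (0 : ℝ) ∈ Set.Ioo (Real.cos Real.pi * Real.cosh Real.pi + 1)
      (Real.cos 0 * Real.cosh 0 + 1) := by
    have := Real.one_lt_cosh.mpr Real.pi_ne_zero
    constructor
    · rw [Real.cos_pi]
      linarith
    · simp
  obtain ⟨z, hz, hz0⟩ := intermediate_value_Ioo' Real.pi_pos.le hcont h0
  exact hγmin z hz.1 (hz.2.trans_le hπ) hz0

theorem cos_mul_cosh_half {γ : ℝ} (h0 : 0 < γ) (hπ : γ < Real.pi)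
    (hγ : Real.cos γ * Real.cosh γ + 1 = 0) :
    Real.cos (γ / 2) * Real.cosh (γ / 2) = Real.sin (γ / 2) * Real.sinh (γ / 2) := by
  have hc : 0 ≤ Real.cos (γ / 2) :=
    Real.cos_nonneg_of_neg_pi_div_two_le_of_le (by linarith) (by linarith)
  have hs : 0 ≤ Real.sin (γ / 2) := Real.sin_nonneg_of_nonneg_of_le_pi (by linarith) (by linarith)
  have hS : 0 ≤ Real.sinh (γ / 2) := Real.sinh_nonneg_iff.mpr (by linarith)
  rw [← sq_eq_sq₀ (mul_nonneg hc (Real.cosh_pos _).le) (mul_nonneg hs hS), mul_pow, mul_pow,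
    Real.sin_sq, Real.sinh_sq]
  have e1 := Real.cos_two_mul (γ / 2)
  have e2 := Real.cosh_two_mul (γ / 2)
  rw [Real.sinh_sq] at e2
  rw [mul_div_cancel₀ γ two_ne_zero] at e1 e2
  rw [e1, e2] at hγ
  linear_combination hγ / 2

theorem reflInt_beamMode {γ : ℝ} (h0 : 0 < γ) (hπ : γ < Real.pi)
    (hγ : Real.cos γ * Real.cosh γ + 1 = 0) (x : ℝ) :
    γ ^ 2 * reflInt (beamMode γ) x = beamMode γ x := by
  have hs : Real.sin (γ / 2) ≠ 0 :=
    (Real.sin_pos_of_pos_of_lt_pi (by linarith) (by linarith)).ne'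
  have hC : Real.cosh (γ / 2) ≠ 0 := (Real.cosh_pos _).ne'
  have hu : ∀ y : ℝ, HasDerivAt (fun y => γ * (y - 1 / 2)) γ y := fun y => by
    simpa only [mul_one] using ((hasDerivAt_id' y).sub_const (1 / 2)).const_mul γ
  have h := integral_mul_of_hasDerivAt
    (F := fun y => Real.cosh (γ * (y - 1 / 2)) / Real.cosh (γ / 2) +
      Real.sin (γ * (y - 1 / 2)) / Real.sin (γ / 2))
    (G := fun y => Real.sinh (γ * (y - 1 / 2)) * γ / Real.cosh (γ / 2) +
      Real.cos (γ * (y - 1 / 2)) * γ / Real.sin (γ / 2))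
    (f := fun y => γ ^ 2 * beamMode γ y)
    (fun y => ((hu y).cosh.div_const _).add ((hu y).sin.div_const _))
    (fun y => ((((hu y).sinh.mul_const γ).div_const _).add
      (((hu y).cos.mul_const γ).div_const _)).congr_deriv (by rw [beamMode]; ring))
    ((continuous_beamMode γ).const_mul _) ?_ ?_ (1 - x)
  · rw [← reflInt_const_mul, reflInt, h, beamMode,
      show γ * (1 - x - 1 / 2) = -(γ * (x - 1 / 2)) by ring, Real.cosh_neg, Real.sin_neg]
    ring
  · rw [show γ * (0 - 1 / 2) = -(γ / 2) by ring, Real.cosh_neg, Real.sin_neg]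
    field_simp
    ring
  · rw [show γ * (0 - 1 / 2) = -(γ / 2) by ring, Real.sinh_neg, Real.cos_neg]
    field_simp
    linear_combination γ * cos_mul_cosh_half h0 hπ hγ

theorem beamMode_le_two {γ x : ℝ} (h0 : 0 < γ) (hπ : γ < Real.pi) (hx0 : 0 ≤ x) (hx : x ≤ 1) :
    beamMode γ x ≤ 2 := by
  have hs : 0 < Real.sin (γ / 2) := Real.sin_pos_of_pos_of_lt_pi (by linarith) (by linarith)
  have h1 : Real.cosh (γ * (x - 1 / 2)) / Real.cosh (γ / 2) ≤ 1 := by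
    rw [div_le_one (Real.cosh_pos _), Real.cosh_le_cosh, abs_le, abs_of_pos (by linarith)]
    constructor <;> nlinarith
  have h2 : -1 ≤ Real.sin (γ * (x - 1 / 2)) / Real.sin (γ / 2) := by
    rw [le_div_iff₀ hs, neg_one_mul, ← Real.sin_neg]
    exact Real.sin_le_sin_of_le_of_le_pi_div_two (by linarith) (by nlinarith) (by nlinarith)
  rw [beamMode]
  linarith

theorem inv_cosh_le_beamMode {γ x : ℝ} (h0 : 0 < γ) (hπ : γ < Real.pi) (hx0 : 0 ≤ x)
    (hx : x ≤ 1 / 2) : (Real.cosh (γ / 2))⁻¹ ≤ beamMode γ x := by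
  have hs : 0 < Real.sin (γ / 2) := Real.sin_pos_of_pos_of_lt_pi (by linarith) (by linarith)
  have h1 : (Real.cosh (γ / 2))⁻¹ ≤ Real.cosh (γ * (x - 1 / 2)) / Real.cosh (γ / 2) := by
    rw [inv_eq_one_div]
    exact div_le_div_of_nonneg_right (Real.one_le_cosh _) (Real.cosh_pos _).le
  have h2 : Real.sin (γ * (x - 1 / 2)) / Real.sin (γ / 2) ≤ 0 :=
    div_nonpos_of_nonpos_of_nonneg
      (Real.sin_nonpos_of_nonpos_of_neg_pi_le (by nlinarith) (by nlinarith)) hs.le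
  rw [beamMode]
  linarith

/-- If `γ` is the smallest positive solution of `cos z cosh z + 1 = 0`, then there is a
constant `α > 0` with `A(2n−1) γ^{2n}/(2n−1)! → α` as `n → ∞`; equivalently,
`♯(P_n) = n·A(2n−1) ∼ α n (2n−1)!/γ^{2n}`. -/
theorem asymptotics_2up2down
    (γ : ℝ) (hγpos : 0 < γ) (hγ : Real.cos γ * Real.cosh γ + 1 = 0)
    (hγmin : ∀ z : ℝ, 0 < z → z < γ → Real.cos z * Real.cosh z + 1 ≠ 0) :
    ∃ α : ℝ, 0 < α ∧
      Filter.Tendsto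
        (fun n : ℕ => (numTwoUpTwoDown (2 * n - 1) : ℝ) * γ ^ (2 * n) / (2 * n - 1).factorial)
        Filter.atTop (nhds α) := by
  have hπ := lt_pi_of_minimal hγmin
  have hφ := continuous_beamMode γ
  have heig := reflInt_beamMode hγpos hπ hγ
  set μ := (Real.cosh (γ / 2))⁻¹ with hμ
  have hμ0 : 0 < μ := inv_pos.mpr (Real.cosh_pos _)
  have hupper : ∀ x, 0 ≤ x → x ≤ 1 → beamMode γ x ≤ γ ^ 2 * (1 - x) ^ 2 := by
    intro x hx0 hx
    have h := reflInt_mono hφ (continuous_const (y := (2 : ℝ))) hx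
      fun t ht0 ht => beamMode_le_two hγpos hπ ht0 (by linarith)
    rw [reflInt_const, mul_div_cancel₀ _ two_ne_zero] at h
    rw [← heig]
    exact mul_le_mul_of_nonneg_left h (sq_nonneg γ)
  have hlower : ∀ x, 0 ≤ x → x ≤ 1 → min μ (γ ^ 2 * μ / 2) * (1 - x) ^ 2 ≤ beamMode γ x := by
    intro x hx0 hx
    rcases le_total x (1 / 2) with hx2 | hx2
    · calc min μ (γ ^ 2 * μ / 2) * (1 - x) ^ 2 ≤ μ * 1 :=
            mul_le_mul (min_le_left _ _) (by nlinarith) (sq_nonneg _) hμ0.le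
        _ = μ := mul_one μ
        _ ≤ _ := inv_cosh_le_beamMode hγpos hπ hx0 hx2
    · have h := reflInt_mono (continuous_const (y := μ)) hφ hx
        fun t ht0 ht => inv_cosh_le_beamMode hγpos hπ ht0 (by linarith)
      rw [reflInt_const] at h
      calc min μ (γ ^ 2 * μ / 2) * (1 - x) ^ 2 ≤ γ ^ 2 * μ / 2 * (1 - x) ^ 2 :=
            mul_le_mul_of_nonneg_right (min_le_right _ _) (sq_nonneg _)
        _ = γ ^ 2 * (μ * ((1 - x) ^ 2 / 2)) := by ring
        _ ≤ γ ^ 2 * reflInt (beamMode γ) x := mul_le_mul_of_nonneg_left h (sq_nonneg γ)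
        _ = _ := heig x
  obtain ⟨α, hα, hlim⟩ := exists_tendsto_pow_mul_integral_iterate_reflInt (pow_pos hγpos 2)
    (lt_min hμ0 (by positivity)) (pow_pos hγpos 2) hφ heig hlower hupper
  refine ⟨γ ^ 2 * α, by positivity, ?_⟩
  rw [← Filter.tendsto_add_atTop_iff_nat 1]
  refine (hlim.const_mul (γ ^ 2)).congr fun n => ?_
  rw [integral_iterate_reflInt_one, show 2 * (n + 1) - 1 = 2 * n + 1 by omega]
  ring
end

section
/- There exists a unique real number γ with π/2 < γ < π satisfying cos γ · cosh γ + 1 = 0; moreover cos z · cosh z + 1 > 0 for all z with 0 < z < γ (so γ is the smallest positive solution of the equation cos z cosh z + 1 = 0), and 1.875 < γ < 1.876. -/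
open Real in
/-- The function `x ↦ cos x cosh x` is strictly decreasing on `[π/2, π]`. -/
theorem strictAntiOn_cos_mul_cosh :
    StrictAntiOn (fun x : ℝ ↦ cos x * cosh x) (Set.Icc (π / 2) π) := by
  intro x hx y hy hxy
  have hcos : cos y < cos x :=
    strictAntiOn_cos ⟨by linarith [hx.1, pi_pos], hx.2⟩ ⟨by linarith [hy.1, pi_pos], hy.2⟩ hxy
  have hcosx : cos x ≤ 0 := cos_nonpos_of_pi_div_two_le_of_le hx.1 (by linarith [hx.2, pi_pos])
  have hcosh : cosh x ≤ cosh y := by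
    rw [cosh_le_cosh, abs_of_nonneg (by linarith [hx.1, pi_pos]),
      abs_of_nonneg (by linarith [hy.1, pi_pos])]
    exact hxy.le
  show cos y * cosh y < cos x * cosh x
  calc cos y * cosh y < cos x * cosh y := mul_lt_mul_of_pos_right hcos (cosh_pos y)
    _ ≤ cos x * cosh x := mul_le_mul_of_nonpos_left hcosh hcosx

open Real in
/-- A numerical enclosure of `cosh (15 / 8)`. -/
theorem cosh_fifteen_div_eight_bounds : 3.337 < cosh 1.875 ∧ cosh 1.875 < 3.3372 := by
  have h₁ : exp 1.875 = exp 1 ^ 2 * exp (-(1 / 8)) := by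
    rw [← exp_nat_mul, ← exp_add]; norm_num
  have h₂ : exp (-1.875) = exp (-1) ^ 2 * exp (1 / 8) := by
    rw [← exp_nat_mul, ← exp_add]; norm_num
  have hpos := exp_bound (x := 1 / 8) (by norm_num [abs_le]) (n := 5) (by norm_num)
  have hneg := exp_bound (x := -(1 / 8)) (by norm_num [abs_le]) (n := 5) (by norm_num)
  norm_num [Finset.sum_range_succ, Nat.factorial, abs_le] at hpos hneg
  have hpos_lower : 1.13314 < exp (1 / 8) := by norm_num; linarith
  have hpos_upper : exp (1 / 8) < 1.13316 := by norm_num; linarith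
  have hneg_lower : 0.882496 < exp (-(1 / 8)) := by norm_num; linarith
  have hneg_upper : exp (-(1 / 8)) < 0.882498 := by norm_num; linarith
  rw [cosh_eq, h₁, h₂]
  have hsq_lower : 7.38905 < exp 1 ^ 2 := by nlinarith [exp_one_gt_d9]
  have hsq_upper : exp 1 ^ 2 < 7.38906 := by nlinarith [exp_one_gt_d9, exp_one_lt_d9]
  have hinv_lower : 0.13533 < exp (-1) ^ 2 := by nlinarith [exp_neg_one_gt_d9]
  have hinv_upper : exp (-1) ^ 2 < 0.13534 := by
    nlinarith [exp_neg_one_gt_d9, exp_neg_one_lt_d9]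
  constructor
  · have := mul_lt_mul'' hsq_lower hneg_lower (by norm_num) (by norm_num)
    have := mul_lt_mul'' hinv_lower hpos_lower (by norm_num) (by norm_num)
    linarith
  · have := mul_lt_mul'' hsq_upper hneg_upper (by positivity) (by positivity)
    have := mul_lt_mul'' hinv_upper hpos_upper (by positivity) (by positivity)
    linarith

open Real in
theorem neg_lt_cos_fifteen_div_eight : -0.2996 < cos 1.875 := by
  have hmono : sin (1.875 - π / 2) ≤ sin 0.304205 :=
    sin_le_sin_of_le_of_le_pi_div_two (by linarith [pi_lt_d6]) (by linarith [pi_gt_d6])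
      (by linarith [pi_gt_d6])
  have hbound := (abs_le.1 (sin_bound (x := 0.304205) (by norm_num [abs_le]))).2
  rw [abs_of_pos (by norm_num)] at hbound
  rw [sin_sub_pi_div_two] at hmono
  norm_num at hbound hmono ⊢
  linarith

open Real in
theorem cos_lt_neg_three_div_ten : cos 1.876 < -0.3 := by
  have hmono : sin 0.305203 ≤ sin (1.876 - π / 2) :=
    sin_le_sin_of_le_of_le_pi_div_two (by linarith [pi_gt_d6]) (by linarith [pi_gt_d6])
      (by linarith [pi_lt_d6])
  have hbound := sin_gt_sub_cube (x := 0.305203) (by norm_num)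
  rw [sin_sub_pi_div_two] at hmono
  norm_num at hbound hmono ⊢
  linarith

/-- There is a unique `γ ∈ (π/2, π)` with `cos γ cosh γ + 1 = 0`; moreover
`cos z cosh z + 1 > 0` for `0 < z < γ` (so `γ` is the smallest positive solution),
and `1.875 < γ < 1.876`. -/
theorem smallest_positive_root_cos_cosh :
    ∃ γ : ℝ,
      (Real.pi / 2 < γ ∧ γ < Real.pi ∧ Real.cos γ * Real.cosh γ + 1 = 0) ∧
      (∀ γ' : ℝ, Real.pi / 2 < γ' → γ' < Real.pi →
        Real.cos γ' * Real.cosh γ' + 1 = 0 → γ' = γ) ∧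
      (∀ z : ℝ, 0 < z → z < γ → 0 < Real.cos z * Real.cosh z + 1) ∧
      1.875 < γ ∧ γ < 1.876 := by
  have hpi_lower := Real.pi_gt_d6
  have hpi_upper := Real.pi_lt_d6
  obtain ⟨hcosh_lower, hcosh_upper⟩ := cosh_fifteen_div_eight_bounds
  have hleft : -1 < Real.cos 1.875 * Real.cosh 1.875 := by
    nlinarith [neg_lt_cos_fifteen_div_eight]
  have hright : Real.cos 1.876 * Real.cosh 1.876 < -1 := by
    have hcosh : Real.cosh 1.875 ≤ Real.cosh 1.876 := by
      rw [Real.cosh_le_cosh]; norm_num [abs_of_pos]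
    nlinarith [cos_lt_neg_three_div_ten]
  have hcont : ContinuousOn (fun x : ℝ ↦ Real.cos x * Real.cosh x) (Set.Icc 1.875 1.876) :=
    (Real.continuous_cos.mul Real.continuous_cosh).continuousOn
  obtain ⟨γ, ⟨hγ_lower, hγ_upper⟩, hγ⟩ :=
    intermediate_value_Ioo' (by norm_num) hcont ⟨hright, hleft⟩
  have hγ_mem : γ ∈ Set.Icc (Real.pi / 2) Real.pi := ⟨by linarith, by linarith⟩
  refine ⟨γ, ⟨by linarith, by linarith, by simp only at hγ; linarith⟩, ?_, ?_, hγ_lower, hγ_upper⟩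
  · intro γ' h₁ h₂ h
    refine strictAntiOn_cos_mul_cosh.injOn ⟨h₁.le, h₂.le⟩ hγ_mem ?_
    simp only at hγ ⊢
    linarith
  · intro z hz hzγ
    rcases le_total z (Real.pi / 2) with h | h
    · have := mul_nonneg (Real.cos_nonneg_of_mem_Icc ⟨by linarith, h⟩) (Real.cosh_pos z).le
      linarith
    · have := strictAntiOn_cos_mul_cosh ⟨h, by linarith⟩ hγ_mem hzγ
      simp only at hγ this
      linarith
end

section
/- Let n ≥ 1 and let S = {s₁ < s₂ < ⋯ < s_k} be a subset of {1,…,n−1}; set s₀ = 0 and s_{k+1} = n. Then the number of permutations σ of {1,…,n} whose descent set {i ∈ {1,…,n−1} : σ(i) > σ(i+1)} equals S is det M, where M is the (k+1)×(k+1) matrix with entries M_{ij} = binom(s_i, s_{j−1}) for 1 ≤ i, j ≤ k+1 (binomial coefficients, equal to 0 when s_{j−1} > s_i). -/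
/-- `σ` (a permutation of `{1,…,n}` encoded as `Fin n`, 0-indexed) has descent set
exactly `S ⊆ {1,…,n−1}`: for every 1-based position `i` with `1 ≤ i ≤ n−1`,
`σ(i) > σ(i+1)` iff `i ∈ S`. -/
def DescentSetEq {n : ℕ} (σ : Equiv.Perm (Fin n)) (S : Set ℕ) : Prop :=
  ∀ i : ℕ, ∀ _h1 : 1 ≤ i, ∀ h2 : i < n,
    (σ ⟨i, h2⟩ < σ ⟨i - 1, by omega⟩ ↔ i ∈ S)

theorem descentSetEq_empty_iff {n : ℕ} (σ : Equiv.Perm (Fin n)) :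
    DescentSetEq σ ∅ ↔ σ = 1 := by
  constructor
  · intro h
    cases n with
    | zero => exact Subsingleton.elim _ _
    | succ n =>
      have hσ : StrictMono σ := by
        rw [Fin.strictMono_iff_lt_succ]
        intro i
        have hi := (h (i + 1) (by omega) (by omega)).not
        simp only [Set.mem_empty_iff_false, not_false_eq_true, iff_true, not_lt] at hi
        exact lt_of_le_of_ne hi fun e => (Fin.castSucc_lt_succ (i := i)).ne (σ.injective e)
      ext i
      exact congrArg Fin.val (DFunLike.congr_fun
        (Subsingleton.elim (StrictMono.orderIsoOfSurjective σ hσ σ.surjective)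
          (OrderIso.refl _)) i)
  · rintro rfl i h1 h2
    simp only [Equiv.Perm.coe_one, id_eq, Set.mem_empty_iff_false, iff_false, not_lt,
      Fin.mk_le_mk]
    omega

/-- The permutation of `Fin (m + l)` whose first `m` values form the set `T`, arranged in the
pattern `τ`, and whose last `l` values form the complement of `T`, arranged in the pattern `υ`. -/
def shufflePerm {m l : ℕ} (T : {T : Finset (Fin (m + l)) // T.card = m})
    (τ : Equiv.Perm (Fin m)) (υ : Equiv.Perm (Fin l)) : Equiv.Perm (Fin (m + l)) :=
  finSumFinEquiv.symm.trans ((Equiv.Perm.sumCongr τ υ).trans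
    (finSumEquivOfFinset T.2 (by rw [Finset.card_compl, T.2, Fintype.card_fin]; omega)))

theorem shufflePerm_castAdd {m l : ℕ} (T : {T : Finset (Fin (m + l)) // T.card = m})
    (τ : Equiv.Perm (Fin m)) (υ : Equiv.Perm (Fin l)) (a : Fin m) :
    shufflePerm T τ υ (Fin.castAdd l a) = T.1.orderEmbOfFin T.2 (τ a) := by
  simp [shufflePerm]

theorem shufflePerm_natAdd {m l : ℕ} (T : {T : Finset (Fin (m + l)) // T.card = m})
    (τ : Equiv.Perm (Fin m)) (υ : Equiv.Perm (Fin l)) (b : Fin l) :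
    shufflePerm T τ υ (Fin.natAdd m b) = T.1ᶜ.orderEmbOfFin
      (by rw [Finset.card_compl, T.2, Fintype.card_fin]; omega) (υ b) := by
  simp [shufflePerm]

theorem shufflePerm_castAdd_mem {m l : ℕ} (T : {T : Finset (Fin (m + l)) // T.card = m})
    (τ : Equiv.Perm (Fin m)) (υ : Equiv.Perm (Fin l)) (a : Fin m) :
    shufflePerm T τ υ (Fin.castAdd l a) ∈ T.1 := by
  rw [shufflePerm_castAdd]
  exact Finset.orderEmbOfFin_mem _ _ _

theorem image_shufflePerm {m l : ℕ} (T : {T : Finset (Fin (m + l)) // T.card = m})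
    (τ : Equiv.Perm (Fin m)) (υ : Equiv.Perm (Fin l)) :
    Finset.univ.image (fun a => shufflePerm T τ υ (Fin.castAdd l a)) = T.1 := by
  apply Finset.eq_of_subset_of_card_le
  · intro x hx
    obtain ⟨a, -, rfl⟩ := Finset.mem_image.1 hx
    exact shufflePerm_castAdd_mem T τ υ a
  · rw [Finset.card_image_of_injective _
      fun a b h => Fin.castAdd_injective m l ((shufflePerm T τ υ).injective h), T.2]
    simp

theorem shufflePerm_bijective (m l : ℕ) :
    Function.Bijective fun p : {T : Finset (Fin (m + l)) // T.card = m} ×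
      Equiv.Perm (Fin m) × Equiv.Perm (Fin l) => shufflePerm p.1 p.2.1 p.2.2 := by
  constructor
  · rintro ⟨T, τ, υ⟩ ⟨T', τ', υ'⟩ h
    simp only at h
    obtain rfl : T = T' := Subtype.ext <| by
      rw [← image_shufflePerm T τ υ, h, image_shufflePerm T' τ' υ']
    congr 2
    · ext a : 1
      apply (T.1.orderEmbOfFin T.2).injective
      rw [← shufflePerm_castAdd T τ υ, h, shufflePerm_castAdd]
    · ext b : 1
      apply (T.1ᶜ.orderEmbOfFin
        (by rw [Finset.card_compl, T.2, Fintype.card_fin]; omega) : Fin l ↪o _).injective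
      rw [← shufflePerm_natAdd T τ υ, h, shufflePerm_natAdd]
  · intro σ
    let T : {T : Finset (Fin (m + l)) // T.card = m} :=
      ⟨Finset.univ.image fun a : Fin m => σ (Fin.castAdd l a), by
        rw [Finset.card_image_of_injective _
          fun a b h => Fin.castAdd_injective m l (σ.injective h)]
        simp⟩
    let e : Fin m ⊕ Fin l ≃ Fin (m + l) := finSumEquivOfFinset T.2
      (by rw [Finset.card_compl, T.2, Fintype.card_fin]; omega)
    have hmaps : Set.MapsTo (finSumFinEquiv.trans (σ.trans e.symm))
        (Set.range Sum.inl) (Set.range Sum.inl) := by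
      rintro _ ⟨a, rfl⟩
      have ha : σ (Fin.castAdd l a) ∈ T.1 := Finset.mem_image_of_mem _ (Finset.mem_univ a)
      rw [← Finset.mem_coe, ← Finset.range_orderEmbOfFin T.1 T.2] at ha
      obtain ⟨b, hb⟩ := ha
      refine ⟨b, ?_⟩
      simp only [Equiv.trans_apply, finSumFinEquiv_apply_left]
      rw [Equiv.eq_symm_apply, ← hb]
      exact finSumEquivOfFinset_inl _ _ _
    obtain ⟨⟨τ, υ⟩, h⟩ := Equiv.Perm.mem_sumCongrHom_range_of_perm_mapsTo_inl hmaps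
    refine ⟨⟨T, τ, υ⟩, ?_⟩
    rw [Equiv.Perm.sumCongrHom_apply] at h
    change finSumFinEquiv.symm.trans ((Equiv.Perm.sumCongr τ υ).trans e) = σ
    simp only at h
    rw [h]
    ext x : 1
    simp

theorem shufflePerm_descents_iff {m l : ℕ} {S : Set ℕ} (hS : ∀ i ∈ S, i < m)
    (T : {T : Finset (Fin (m + l)) // T.card = m})
    (τ : Equiv.Perm (Fin m)) (υ : Equiv.Perm (Fin l)) :
    (∀ i : ℕ, ∀ _h1 : 1 ≤ i, ∀ h2 : i < m + l, i ≠ m →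
      (shufflePerm T τ υ ⟨i, h2⟩ < shufflePerm T τ υ ⟨i - 1, by omega⟩ ↔ i ∈ S)) ↔
      DescentSetEq τ S ∧ υ = 1 := by
  have hleft : ∀ i (h1 : 1 ≤ i) (h : i < m),
      (shufflePerm T τ υ ⟨i, by omega⟩ < shufflePerm T τ υ ⟨i - 1, by omega⟩ ↔
        τ ⟨i, h⟩ < τ ⟨i - 1, by omega⟩) := by
    intro i h1 h
    rw [← (T.1.orderEmbOfFin T.2).lt_iff_lt, ← shufflePerm_castAdd T τ υ,
      ← shufflePerm_castAdd T τ υ]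
    rfl
  have hright : ∀ i (h1 : 1 ≤ i) (h : i < l),
      (shufflePerm T τ υ ⟨m + i, by omega⟩ < shufflePerm T τ υ ⟨m + i - 1, by omega⟩ ↔
        υ ⟨i, h⟩ < υ ⟨i - 1, by omega⟩) := by
    intro i h1 h
    rw [← (T.1ᶜ.orderEmbOfFin
        (by rw [Finset.card_compl, T.2, Fintype.card_fin]; omega) : Fin l ↪o _).lt_iff_lt,
      ← shufflePerm_natAdd T τ υ, ← shufflePerm_natAdd T τ υ]
    have : (⟨m + i - 1, by omega⟩ : Fin (m + l)) = Fin.natAdd m ⟨i - 1, by omega⟩ :=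
      Fin.ext (by simp only [Fin.natAdd_mk]; omega)
    rw [this]
    rfl
  rw [← descentSetEq_empty_iff]
  constructor
  · intro h
    refine ⟨fun i h1 h2 => ?_, fun i h1 h2 => ?_⟩
    · rw [← hleft i h1 h2]
      exact h i h1 (by omega) h2.ne
    · rw [← hright i h1 h2, h (m + i) (by omega) (by omega) (by omega)]
      simp only [Set.mem_empty_iff_false, iff_false]
      intro hi
      have := hS _ hi
      omega
  · rintro ⟨hτ, hυ⟩ i h1 h2 hne
    rcases lt_or_gt_of_ne hne with h | h
    · rw [hleft i h1 h]
      exact hτ i h1 h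
    · obtain ⟨j, rfl⟩ := Nat.exists_eq_add_of_lt h
      rw [show m + j + 1 = m + (j + 1) by omega] at *
      have hb := hυ (j + 1) (by omega) (by omega)
      rw [← hright (j + 1) (by omega) (by omega)] at hb
      refine hb.trans ⟨False.elim, fun hi => ?_⟩
      have := hS _ hi
      omega

theorem card_descents_away_from {m l : ℕ} {S : Set ℕ} (hS : ∀ i ∈ S, i < m) :
    Nat.card {σ : Equiv.Perm (Fin (m + l)) // ∀ i : ℕ, ∀ _h1 : 1 ≤ i, ∀ h2 : i < m + l, i ≠ m →
      (σ ⟨i, h2⟩ < σ ⟨i - 1, by omega⟩ ↔ i ∈ S)} =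
      (m + l).choose m * Nat.card {τ : Equiv.Perm (Fin m) // DescentSetEq τ S} := by
  have hT : Nat.card {T : Finset (Fin (m + l)) // T.card = m} = (m + l).choose m := by
    rw [Nat.card_eq_fintype_card, Fintype.card_finset_len, Fintype.card_fin]
  rw [← hT, ← Nat.card_prod]
  symm
  refine Nat.card_congr (Equiv.ofBijective (fun p => ⟨shufflePerm p.1 p.2.1 1,
    (shufflePerm_descents_iff hS _ _ _).2 ⟨p.2.2, rfl⟩⟩) ⟨?_, ?_⟩)
  · rintro ⟨T, τ, hτ⟩ ⟨T', τ', hτ'⟩ h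
    have := @(shufflePerm_bijective m l).1 (T, τ, 1) (T', τ', 1) (congrArg Subtype.val h)
    simp only [Prod.mk.injEq, and_true] at this
    obtain ⟨rfl, rfl⟩ := this
    rfl
  · rintro ⟨σ, hσ⟩
    obtain ⟨⟨T, τ, υ⟩, rfl⟩ := (shufflePerm_bijective m l).2 σ
    obtain ⟨hτ, rfl⟩ := (shufflePerm_descents_iff hS T τ υ).1 hσ
    exact ⟨(T, ⟨τ, hτ⟩), rfl⟩

theorem card_descentSetEq_insert_add {m n : ℕ} (hm : 1 ≤ m) (hmn : m < n) {S : Set ℕ}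
    (hS : ∀ i ∈ S, i < m) :
    Nat.card {σ : Equiv.Perm (Fin n) // DescentSetEq σ (insert m S)} +
      Nat.card {σ : Equiv.Perm (Fin n) // DescentSetEq σ S} =
      n.choose m * Nat.card {τ : Equiv.Perm (Fin m) // DescentSetEq τ S} := by
  obtain ⟨l, rfl⟩ := Nat.exists_eq_add_of_le hmn.le
  have hmS : m ∉ S := fun h => (hS m h).false
  rw [← card_descents_away_from hS]
  change Set.ncard {σ : Equiv.Perm (Fin (m + l)) | DescentSetEq σ (insert m S)} +
    Set.ncard {σ : Equiv.Perm (Fin (m + l)) | DescentSetEq σ S} = Set.ncard {σ | _}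
  rw [← Set.ncard_union_eq]
  · congr 1
    ext σ
    simp only [Set.mem_union, Set.mem_ofPred_eq]
    constructor
    · rintro (h | h) i h1 h2 hne
      · simpa [hne] using h i h1 h2
      · exact h i h1 h2
    · intro h
      by_cases hd : σ ⟨m, hmn⟩ < σ ⟨m - 1, by omega⟩
      · left
        intro i h1 h2
        by_cases hne : i = m
        · subst hne
          simpa using hd
        · simpa [hne] using h i h1 h2 hne
      · right
        intro i h1 h2
        by_cases hne : i = m
        · subst hne
          exact iff_of_false hd hmS
        · exact h i h1 h2 hne
  · rw [Set.disjoint_left]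
    intro σ h h'
    exact hmS ((h' m hm hmn).1 ((h m hm hmn).2 (Set.mem_insert _ _)))

theorem det_choose_succ (s : ℕ → ℕ) (k n : ℕ) (hs : StrictMonoOn s (Set.Icc 0 (k + 1))) :
    Matrix.det (Matrix.of fun i j : Fin (k + 2) =>
      ((if i.1 < k + 1 then s (i.1 + 1) else n).choose (s j.1) : ℤ)) =
    n.choose (s (k + 1)) * Matrix.det (Matrix.of fun i j : Fin (k + 1) =>
      ((if i.1 < k then s (i.1 + 1) else s (k + 1)).choose (s j.1) : ℤ)) -
    Matrix.det (Matrix.of fun i j : Fin (k + 1) =>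
      ((if i.1 < k then s (i.1 + 1) else n).choose (s j.1) : ℤ)) := by
  rw [Matrix.det_succ_column _ (Fin.last (k + 1)), Fin.sum_univ_castSucc, Fin.sum_univ_castSucc,
    Finset.sum_eq_zero, zero_add, add_comm, sub_eq_add_neg]
  · congr 1
    · have hsign : ((-1 : ℤ)) ^ (k + 1 + (k + 1)) = 1 := Even.neg_one_pow ⟨k + 1, rfl⟩
      simp only [Fin.val_last, hsign, Matrix.of_apply, lt_irrefl, if_false, one_mul]
      congr 2
      ext i j
      have hi := i.2
      simp only [Matrix.submatrix_apply, Matrix.of_apply, Fin.succAbove_last, Fin.val_castSucc,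
        if_pos hi]
      split_ifs with h
      · rfl
      · rw [show i.1 = k by omega]
    · have hsign : ((-1 : ℤ)) ^ (k + (k + 1)) = -1 := Odd.neg_one_pow ⟨k, by ring⟩
      simp only [Fin.val_last, Fin.val_castSucc, hsign, Matrix.of_apply, Nat.lt_succ_self, if_true,
        Nat.choose_self, Nat.cast_one, mul_one, neg_mul, one_mul]
      congr 2
      ext i j
      simp only [Matrix.submatrix_apply, Matrix.of_apply, Fin.succAbove_last, Fin.val_castSucc]
      by_cases h : i.1 < k
      · rw [Fin.succAbove_of_castSucc_lt _ _ (by simpa [Fin.lt_def] using h)]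
        simp only [Fin.val_castSucc, if_pos h, if_pos i.2]
      · rw [Fin.succAbove_of_le_castSucc _ _ (by simpa [Fin.le_def] using h)]
        simp [h]
  · intro i _
    have hi := i.2
    have hlt : s (i.1 + 1) < s (k + 1) :=
      hs (by simp) (by simp) (by omega)
    simp [Nat.choose_eq_zero_of_lt hlt]

theorem card_descentSetEq_eq_det (s : ℕ → ℕ) (h0 : s 0 = 0) (k : ℕ) :
    ∀ n : ℕ, StrictMonoOn s (Set.Icc 0 k) → (1 ≤ k → s k < n) →
    (Nat.card {σ : Equiv.Perm (Fin n) // DescentSetEq σ (s '' Set.Icc 1 k)} : ℤ) =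
      Matrix.det (Matrix.of fun i j : Fin (k + 1) =>
        ((if i.1 < k then s (i.1 + 1) else n).choose (s j.1) : ℤ)) := by
  induction k with
  | zero =>
    intro n _ _
    simp [descentSetEq_empty_iff, h0]
  | succ k ih =>
    intro n hs hn
    have hs' : StrictMonoOn s (Set.Icc 0 k) := hs.mono (Set.Icc_subset_Icc_right (by omega))
    have hpos : 1 ≤ s (k + 1) := by
      have := hs (a := 0) (b := k + 1) (by simp) (by simp) (by omega)
      omega
    have hstep : s k < s (k + 1) := hs (by simp) (by simp) (by omega)
    have hn := hn (by omega)
    have hS : ∀ i ∈ s '' Set.Icc 1 k, i < s (k + 1) := by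
      rintro _ ⟨i, hi, rfl⟩
      obtain ⟨hi1, hi2⟩ := hi
      exact hs (by simp; omega) (by simp) (by omega)
    have himage : s '' Set.Icc 1 (k + 1) = insert (s (k + 1)) (s '' Set.Icc 1 k) := by
      rw [← Set.image_insert_eq]
      congr 1
      ext i
      simp only [Set.mem_Icc, Set.mem_insert_iff]
      omega
    have hcard := card_descentSetEq_insert_add hpos hn hS
    rw [det_choose_succ s k n hs, ← ih n hs' fun _ => hstep.trans hn,
      ← ih (s (k + 1)) hs' fun _ => hstep, himage]
    rw [← Nat.cast_mul, ← hcard, Nat.cast_add, add_sub_cancel_right]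

/-- MacMahon–Niven: the number of permutations of `{1,…,n}` with descent set
`S = {s₁ < ⋯ < s_k} ⊆ {1,…,n−1}` (with `s₀ = 0`, `s_{k+1} = n`) equals
`det (binom(s_i, s_{j−1}))_{1 ≤ i,j ≤ k+1}`. -/
theorem count_permutations_with_descent_set
    (n k : ℕ) (hn : 1 ≤ n) (s : ℕ → ℕ)
    (hmono : StrictMonoOn s (Set.Icc 0 (k + 1)))
    (h0 : s 0 = 0) (hlast : s (k + 1) = n)
    (hrange : ∀ i, 1 ≤ i → i ≤ k → 1 ≤ s i ∧ s i ≤ n - 1) :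
    (Nat.card {σ : Equiv.Perm (Fin n) // DescentSetEq σ (s '' Set.Icc 1 k)} : ℤ) =
      Matrix.det (Matrix.of fun i j : Fin (k + 1) => ((s (i.1 + 1)).choose (s j.1) : ℤ)) := by
  rw [card_descentSetEq_eq_det s h0 k n (hmono.mono (Set.Icc_subset_Icc_right (by omega)))
    fun hk => by have := (hrange k hk le_rfl).2; omega]
  congr 2
  funext i j
  split_ifs with h
  · rfl
  · rw [← hlast, show i.1 = k by omega]
end

section
/- For every set C of 4 distinct real numbers, the number of Möbius-equivalence classes (under real Möbius changes of the independent variable) of rational functions over ℝ that are generic of degree 3 with critical value set C equals 2. -/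
open Polynomial

/-- The Wronskian `W = p′q − pq′` of a rational function `f = p/q` (with `p = f.num`,
`q = f.denom` coprime). -/
noncomputable def wronskian' (f : RatFunc ℝ) : Polynomial ℝ :=
  derivative f.num * f.denom - f.num * derivative f.denom

/-- Two rational functions over `ℝ` are Möbius-equivalent if `g = p(L)/q(L)` in `ℝ(X)`
for some `L = (aX+b)/(cX+d)` with real `a, b, c, d`, `ad − bc ≠ 0`, where `f = p/q`. -/
def MobiusEquiv (f g : RatFunc ℝ) : Prop :=
  ∃ a b c d : ℝ, a * d - b * c ≠ 0 ∧
    ∃ L : RatFunc ℝ,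
      L = algebraMap (Polynomial ℝ) (RatFunc ℝ) (C a * X + C b) /
          algebraMap (Polynomial ℝ) (RatFunc ℝ) (C c * X + C d) ∧
      g = Polynomial.aeval L f.num / Polynomial.aeval L f.denom

/-- A rational function `f = p/q` over `ℝ` is generic of degree `n` with critical value
set `C` (a set of `2n−2` distinct reals): `deg f = n`, `deg W = 2n−2`, `q(z) ≠ 0` for
every complex root `z` of `W`, and `{p(z)/q(z) : z ∈ ℂ, W(z) = 0} = C`. -/
def GenericDegR (n : ℕ) (Cv : Set ℝ) (f : RatFunc ℝ) : Prop :=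
  max f.num.natDegree f.denom.natDegree = n ∧
  (wronskian' f).natDegree = 2 * n - 2 ∧
  (∀ z : ℂ, Polynomial.aeval z (wronskian' f) = 0 → Polynomial.aeval z f.denom ≠ 0) ∧
  {w : ℂ | ∃ z : ℂ, Polynomial.aeval z (wronskian' f) = 0 ∧
      Polynomial.aeval z f.num / Polynomial.aeval z f.denom = w} = Complex.ofReal '' Cv

/-- `L` is a real Möbius transformation, viewed as an element of `ℝ(X)`. -/
def IsMoebius (L : RatFunc ℝ) : Prop :=
  ∃ a b c d : ℝ, a * d - b * c ≠ 0 ∧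
    L = (RatFunc.C a * RatFunc.X + RatFunc.C b) / (RatFunc.C c * RatFunc.X + RatFunc.C d)

theorem mobiusEquiv_iff_exists_isMoebius {f g : RatFunc ℝ} :
    MobiusEquiv f g ↔ ∃ L, IsMoebius L ∧ g = aeval L f.num / aeval L f.denom := by
  simp only [MobiusEquiv, IsMoebius, map_add, map_mul, RatFunc.algebraMap_C, RatFunc.algebraMap_X]
  constructor
  · rintro ⟨a, b, c, d, h, L, hL, hg⟩
    exact ⟨L, ⟨a, b, c, d, h, hL⟩, hg⟩
  · rintro ⟨L, ⟨a, b, c, d, h, hL⟩, hg⟩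
    exact ⟨a, b, c, d, h, L, hL, hg⟩

theorem algebraMap_linear (a b : ℝ) :
    algebraMap ℝ[X] (RatFunc ℝ) (C a * X + C b) = RatFunc.C a * RatFunc.X + RatFunc.C b := by
  simp only [map_add, map_mul, RatFunc.algebraMap_C, RatFunc.algebraMap_X]

theorem ratFunc_linear_ne_zero {c d : ℝ} (h : c ≠ 0 ∨ d ≠ 0) :
    RatFunc.C c * RatFunc.X + RatFunc.C d ≠ 0 := by
  rw [← algebraMap_linear]
  refine RatFunc.algebraMap_ne_zero fun h0 => ?_
  have h1 := congrArg (coeff · 1) h0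
  have h2 := congrArg (coeff · 0) h0
  simp at h1 h2
  tauto

theorem ne_zero_or_ne_zero_of_det {a b c d : ℝ} (h : a * d - b * c ≠ 0) : c ≠ 0 ∨ d ≠ 0 := by
  by_contra! h0
  exact h (by rw [h0.1, h0.2]; ring)

/-- Composition of a Möbius expression with a Möbius function. -/
theorem moebius_comp_eq {a b c d a' b' c' d' : ℝ} (h : a * d - b * c ≠ 0)
    (h' : a' * d' - b' * c' ≠ 0) {L : RatFunc ℝ}
    (hL : L = (RatFunc.C a' * RatFunc.X + RatFunc.C b') /
      (RatFunc.C c' * RatFunc.X + RatFunc.C d')) :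
    (RatFunc.C a * L + RatFunc.C b) / (RatFunc.C c * L + RatFunc.C d) =
      (RatFunc.C (a * a' + b * c') * RatFunc.X + RatFunc.C (a * b' + b * d')) /
        (RatFunc.C (c * a' + d * c') * RatFunc.X + RatFunc.C (c * b' + d * d')) := by
  have h1 := ratFunc_linear_ne_zero (ne_zero_or_ne_zero_of_det h')
  have hdet :
      (a * a' + b * c') * (c * b' + d * d') - (a * b' + b * d') * (c * a' + d * c') ≠ 0 := by
    convert mul_ne_zero h h' using 1; ring
  have h2 := ratFunc_linear_ne_zero (ne_zero_or_ne_zero_of_det hdet)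
  have hLD := (eq_div_iff h1).1 hL
  have h3 : RatFunc.C c * L + RatFunc.C d ≠ 0 := by
    intro h0
    apply h2
    simp only [map_add, map_mul]
    linear_combination (RatFunc.C c' * RatFunc.X + RatFunc.C d') * h0 - RatFunc.C c * hLD
  rw [div_eq_div_iff h3 h2]
  simp only [map_add, map_mul]
  linear_combination (RatFunc.C a * RatFunc.C d - RatFunc.C b * RatFunc.C c) * hLD

theorem IsMoebius.exists_inverse {L : RatFunc ℝ} (hL : IsMoebius L) :
    ∃ a b c d : ℝ, a * d - b * c ≠ 0 ∧
      (RatFunc.C a * L + RatFunc.C b) / (RatFunc.C c * L + RatFunc.C d) = RatFunc.X := by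
  obtain ⟨a, b, c, d, h, hL⟩ := hL
  have h' : d * a - (-b) * (-c) ≠ 0 := by convert h using 1; ring
  refine ⟨d, -b, -c, a, h', ?_⟩
  have h0 : RatFunc.C (a * d - b * c) ≠ 0 := (_root_.map_ne_zero RatFunc.C).2 h
  rw [moebius_comp_eq h' h hL, show d * a + -b * c = a * d - b * c by ring,
    show d * b + -b * d = 0 by ring, show -c * a + a * c = 0 by ring,
    show -c * b + a * d = a * d - b * c by ring]
  rw [map_zero, zero_mul, zero_add, add_zero, mul_div_assoc, mul_div_cancel₀ _ h0]

theorem IsMoebius.transcendental {L : RatFunc ℝ} (hL : IsMoebius L) : Transcendental ℝ L := by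
  obtain ⟨a, b, c, d, -, hX⟩ := hL.exists_inverse
  intro hL
  have hC (r : ℝ) : IsAlgebraic ℝ (RatFunc.C r) := by
    rw [← RatFunc.algebraMap_eq_C]; exact isAlgebraic_algebraMap r
  refine RatFunc.transcendental_X (K := ℝ) ?_
  rw [← hX, div_eq_mul_inv]
  exact (((hC a).mul hL).add (hC b)).mul (((hC c).mul hL).add (hC d)).inv

/-- The substitution `X ↦ L`, as an endomorphism of the field `ℝ(X)`. -/
noncomputable def IsMoebius.subst {L : RatFunc ℝ} (hL : IsMoebius L) :
    RatFunc ℝ →ₐ[ℝ] RatFunc ℝ :=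
  RatFunc.liftAlgHom (aeval L)
    (nonZeroDivisors_le_comap_nonZeroDivisors_of_injective _
      (transcendental_iff_injective.1 hL.transcendental))

theorem IsMoebius.subst_apply {L : RatFunc ℝ} (hL : IsMoebius L) (f : RatFunc ℝ) :
    hL.subst f = aeval L f.num / aeval L f.denom :=
  RatFunc.liftAlgHom_apply _ _ _

@[simp]
theorem IsMoebius.subst_X {L : RatFunc ℝ} (hL : IsMoebius L) : hL.subst RatFunc.X = L := by
  simp [hL.subst_apply]

@[simp]
theorem IsMoebius.subst_C {L : RatFunc ℝ} (hL : IsMoebius L) (r : ℝ) :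
    hL.subst (RatFunc.C r) = RatFunc.C r := by
  rw [← RatFunc.algebraMap_eq_C]
  exact hL.subst.commutes r

theorem mobiusEquiv_iff_exists_subst {f g : RatFunc ℝ} :
    MobiusEquiv f g ↔ ∃ L, ∃ hL : IsMoebius L, g = hL.subst f := by
  simp only [mobiusEquiv_iff_exists_isMoebius, IsMoebius.subst_apply, exists_prop]

theorem IsMoebius.comp {L M : RatFunc ℝ} (hL : IsMoebius L) (hM : IsMoebius M) :
    IsMoebius (hM.subst L) := by
  obtain ⟨a, b, c, d, h, rfl⟩ := hL
  obtain ⟨a', b', c', d', h', hM'⟩ := id hM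
  refine ⟨a * a' + b * c', a * b' + b * d', c * a' + d * c', c * b' + d * d', ?_, ?_⟩
  · convert mul_ne_zero h h' using 1; ring
  · simp only [map_div₀, map_add (hM.subst), map_mul (hM.subst), subst_X, subst_C]
    exact moebius_comp_eq h h' hM'

theorem IsMoebius.subst_subst {L M : RatFunc ℝ} (hL : IsMoebius L) (hM : IsMoebius M)
    (f : RatFunc ℝ) : hM.subst (hL.subst f) = (hL.comp hM).subst f := by
  simp [IsMoebius.subst_apply, ← aeval_algHom_apply]

theorem isMoebius_X : IsMoebius RatFunc.X := ⟨1, 0, 0, 1, by simp, by simp⟩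

theorem subst_isMoebius_X (f : RatFunc ℝ) : isMoebius_X.subst f = f := by
  conv_rhs => rw [← RatFunc.num_div_denom f]
  simp [IsMoebius.subst_apply, ← RatFunc.algebraMap_X, aeval_algebraMap_apply]

/-- Every Möbius function has a right inverse under substitution. -/
theorem IsMoebius.exists_subst_eq_X {L : RatFunc ℝ} (hL : IsMoebius L) :
    ∃ M, ∃ _ : IsMoebius M, hL.subst M = RatFunc.X := by
  obtain ⟨a, b, c, d, h, hX⟩ := hL.exists_inverse
  exact ⟨_, ⟨a, b, c, d, h, rfl⟩, by simpa using hX⟩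

theorem IsMoebius.exists_subst_self_eq_X {L : RatFunc ℝ} (hL : IsMoebius L) :
    ∃ M, ∃ hM : IsMoebius M, hM.subst L = RatFunc.X := by
  obtain ⟨M, hM, hLM⟩ := hL.exists_subst_eq_X
  obtain ⟨N, hN, hMN⟩ := hM.exists_subst_eq_X
  have : L = N := by
    have h1 : hL.subst (hM.subst N) = N := by
      rw [hM.subst_subst]
      simp only [hLM]
      exact subst_isMoebius_X N
    rw [← h1, hMN, subst_X]
  exact ⟨M, hM, this ▸ hMN⟩

/-- Any two Möbius functions differ by a substitution. -/
theorem IsMoebius.exists_subst_eq {L L' : RatFunc ℝ} (hL : IsMoebius L) (hL' : IsMoebius L') :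
    ∃ M, ∃ hM : IsMoebius M, hM.subst L = L' := by
  obtain ⟨N, hN, hNL⟩ := hL.exists_subst_self_eq_X
  exact ⟨_, hN.comp hL', by rw [← hN.subst_subst hL', hNL, subst_X]⟩

/-- Up to a Möbius change `L` of the independent variable, `f` satisfies
`(f - w₁) / (f - w₂) = κ L² (L - (2s+1)(s+2)) / (L - s)` with `κ = -v / (2s+1)³`. The map on the
right has critical points `0`, `∞`, `s(s+2)` and `2s+1`, and takes the value `v` at `2s+1`. -/
def HasNormalForm (w₁ w₂ v s : ℝ) (f : RatFunc ℝ) : Prop :=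
  ∃ L, IsMoebius L ∧
    RatFunc.C ((2 * s + 1) ^ 3) * (L - RatFunc.C s) * (f - RatFunc.C w₁) =
      RatFunc.C (-v) * L ^ 2 * (L - RatFunc.C ((2 * s + 1) * (s + 2))) * (f - RatFunc.C w₂)

theorem HasNormalForm.subst {w₁ w₂ v s : ℝ} {f M : RatFunc ℝ} (hf : HasNormalForm w₁ w₂ v s f)
    (hM : IsMoebius M) : HasNormalForm w₁ w₂ v s (hM.subst f) := by
  obtain ⟨L, hL, h⟩ := hf
  refine ⟨_, hL.comp hM, ?_⟩
  have := congrArg hM.subst h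
  simpa only [map_mul (hM.subst), map_sub (hM.subst), map_pow (hM.subst), hM.subst_C] using this

theorem IsMoebius.ne_C {L : RatFunc ℝ} (hL : IsMoebius L) (r : ℝ) : L ≠ RatFunc.C r := by
  rintro rfl
  refine hL.transcendental ?_
  rw [← RatFunc.algebraMap_eq_C]
  exact isAlgebraic_algebraMap r

/-- Two functions with the same normal form differ by a Möbius change of variable. -/
theorem HasNormalForm.mobiusEquiv {w₁ w₂ v s : ℝ} (hw : w₁ ≠ w₂) (hs : 2 * s + 1 ≠ 0)
    {f g : RatFunc ℝ} (hf : HasNormalForm w₁ w₂ v s f) (hg : HasNormalForm w₁ w₂ v s g) :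
    MobiusEquiv f g := by
  obtain ⟨L, hL, h⟩ := hf
  obtain ⟨L', hL', h'⟩ := hg
  obtain ⟨M, hM, rfl⟩ := hL.exists_subst_eq hL'
  refine mobiusEquiv_iff_exists_subst.2 ⟨M, hM, ?_⟩
  have h := congrArg hM.subst h
  simp only [map_mul (hM.subst), map_sub (hM.subst), map_pow (hM.subst), hM.subst_C] at h
  set A := RatFunc.C ((2 * s + 1) ^ 3) * (hM.subst L - RatFunc.C s) with hA
  set B := RatFunc.C (-v) * hM.subst L ^ 2 *
    (hM.subst L - RatFunc.C ((2 * s + 1) * (s + 2))) with hB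
  have hA0 : A ≠ 0 :=
    mul_ne_zero ((_root_.map_ne_zero RatFunc.C).2 (pow_ne_zero 3 hs)) (sub_ne_zero.2 (hL'.ne_C s))
  have hw' : RatFunc.C w₂ - RatFunc.C w₁ ≠ 0 := sub_ne_zero.2 (RatFunc.C_injective.ne hw.symm)
  have hAB : A - B ≠ 0 := fun h0 =>
    mul_ne_zero hA0 hw' (by linear_combination h + (hM.subst f - RatFunc.C w₂) * -h0)
  refine mul_left_cancel₀ hAB ?_
  linear_combination h' - h

theorem coeff_eq_zero_of_forall_eq_zero {c₀ c₁ c₂ c₃ c₄ c₅ c₆ : ℝ}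
    (h : ∀ x : ℝ, c₀ + c₁ * x + c₂ * x ^ 2 + c₃ * x ^ 3 + c₄ * x ^ 4 + c₅ * x ^ 5 +
      c₆ * x ^ 6 = 0) :
    c₀ = 0 ∧ c₁ = 0 ∧ c₂ = 0 ∧ c₃ = 0 ∧ c₄ = 0 ∧ c₅ = 0 ∧ c₆ = 0 := by
  have h0 := h 0
  have h1 := h 1
  have h2 := h (-1)
  have h3 := h 2
  have h4 := h (-2)
  have h5 := h 3
  have h6 := h (-3)
  norm_num at h0 h1 h2 h3 h4 h5 h6
  refine ⟨?_, ?_, ?_, ?_, ?_, ?_, ?_⟩ <;> linarith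

/-- A Möbius map `x ↦ (ax+b)/(cx+d)` carrying one normal form to another one is trivial. -/
theorem param_eq_of_forall_eq {s t a b c d : ℝ} (hs : s ≠ 0) (hs' : s ≠ -1) (hs2 : 2 * s + 1 ≠ 0)
    (ht2 : 2 * t + 1 ≠ 0) (hs3 : s * (s + 2) ^ 3 ≠ (2 * s + 1) ^ 3) (hdet : a * d - b * c ≠ 0)
    (h : ∀ x : ℝ, (2 * s + 1) ^ 3 * (x - s) * (a * x + b) ^ 2 *
        ((a * x + b) - (2 * t + 1) * (t + 2) * (c * x + d)) =
      (2 * t + 1) ^ 3 * ((a * x + b) - t * (c * x + d)) * (c * x + d) ^ 2 * x ^ 2 *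
        (x - (2 * s + 1) * (s + 2))) :
    s = t := by
  have hσ : (2 * s + 1) ^ 3 ≠ 0 := pow_ne_zero 3 hs2
  have hτ : (2 * t + 1) ^ 3 ≠ 0 := pow_ne_zero 3 ht2
  generalize hσ' : (2 * s + 1) ^ 3 = σ at *
  generalize hτ' : (2 * t + 1) ^ 3 = τ at *
  generalize hB : (2 * s + 1) * (s + 2) = B at *
  generalize hB' : (2 * t + 1) * (t + 2) = B' at *
  obtain ⟨h0, h1, h2, h3, h4, h5, h6⟩ := coeff_eq_zero_of_forall_eq_zero
    (c₀ := -σ * s * b ^ 2 * (b - B' * d))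
    (c₁ := σ * (b ^ 2 * (b - B' * d) - s * (2 * a * b * (b - B' * d) + b ^ 2 * (a - B' * c))))
    (c₂ := σ * (2 * a * b * (b - B' * d) + b ^ 2 * (a - B' * c) -
      s * (a ^ 2 * (b - B' * d) + 2 * a * b * (a - B' * c))) + τ * B * (b - t * d) * d ^ 2)
    (c₃ := σ * (a ^ 2 * (b - B' * d) + 2 * a * b * (a - B' * c) - s * a ^ 2 * (a - B' * c)) -
      τ * ((b - t * d) * d ^ 2 - B * ((a - t * c) * d ^ 2 + 2 * c * d * (b - t * d))))
    (c₄ := σ * a ^ 2 * (a - B' * c) - τ * ((a - t * c) * d ^ 2 + 2 * c * d * (b - t * d) -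
      B * (2 * c * d * (a - t * c) + c ^ 2 * (b - t * d))))
    (c₅ := -τ * (2 * c * d * (a - t * c) + c ^ 2 * (b - t * d) - B * c ^ 2 * (a - t * c)))
    (c₆ := -τ * c ^ 2 * (a - t * c))
    (fun x => by linear_combination h x)
  have hb : b = 0 := by
    by_contra hb
    have e1 : b - B' * d = 0 := by simpa [hσ, hs, hb] using h0
    have e2 : a - B' * c = 0 := by
      rw [e1] at h1
      simpa [hσ, hs, hb] using h1
    exact hdet (by linear_combination d * e2 - c * e1)
  subst hb
  have hc : c = 0 := by
    by_contra hc
    have e1 : a - t * c = 0 := by simpa [hτ, hc] using h6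
    rw [e1] at h5
    have e2 : t * d = 0 := by simpa [hτ, hc] using h5
    exact hdet (by linear_combination d * e1 + c * e2)
  subst hc
  have ha : a ≠ 0 := by rintro rfl; simp at hdet
  have hd : d ≠ 0 := by rintro rfl; simp at hdet
  have e4 : σ * a ^ 2 = τ * d ^ 2 := mul_left_cancel₀ ha (by linear_combination h4)
  have hτd : τ * d ^ 2 ≠ 0 := mul_ne_zero hτ (pow_ne_zero 2 hd)
  have e3 : a * s + B' * d = t * d + a * B :=
    mul_left_cancel₀ hτd (by linear_combination -h3 + (-a * s - B' * d) * e4)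
  have e2 : s * B' = t * B :=
    mul_left_cancel₀ (mul_ne_zero hτd hd) (by linear_combination h2 - d * s * B' * e4)
  by_contra hst
  have e5 : s * t = 1 := by
    refine mul_left_cancel₀ (sub_ne_zero.2 hst) ?_
    rw [← hB, ← hB'] at e2
    linear_combination -e2 / 2
  have hs1 : (s + 1) ^ 2 ≠ 0 := pow_ne_zero 2 fun h => hs' (by linear_combination h)
  have e6 : a * s ^ 2 = d := by
    refine mul_left_cancel₀ hs1 ?_
    rw [← hB, ← hB'] at e3
    linear_combination -e3 * s ^ 2 / 2 + d * (s * t + 1 + 2 * s) * e5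
  have e7 : τ * s ^ 3 = (s + 2) ^ 3 := by
    rw [← hτ', ← mul_pow]
    congr 1
    linear_combination 2 * e5
  have e8 : σ = τ * s ^ 4 := by
    refine mul_right_cancel₀ (pow_ne_zero 2 ha) ?_
    rw [e4, ← e6]
    ring
  exact hs3 (by linear_combination -s * e7 - e8)

/-- The parameter of the normal form of a function is unique. -/
theorem HasNormalForm.param_unique {w₁ w₂ v s t : ℝ} (hw : w₁ ≠ w₂) (hv : v ≠ 0) (hs : s ≠ 0)
    (hs' : s ≠ -1) (hs2 : 2 * s + 1 ≠ 0) (ht2 : 2 * t + 1 ≠ 0)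
    (hs3 : s * (s + 2) ^ 3 ≠ (2 * s + 1) ^ 3) {f : RatFunc ℝ}
    (hf : HasNormalForm w₁ w₂ v s f) (hf' : HasNormalForm w₁ w₂ v t f) : s = t := by
  obtain ⟨L₀, hL₀, h⟩ := hf
  obtain ⟨M, hM, hML⟩ := hL₀.exists_subst_self_eq_X
  obtain ⟨L, ⟨a, b, c, d, hdet, hL⟩, h'⟩ := hf'.subst hM
  have h := congrArg hM.subst h
  simp only [map_mul (hM.subst), map_sub (hM.subst), map_pow (hM.subst), hM.subst_C, hML] at h
  refine param_eq_of_forall_eq hs hs' hs2 ht2 hs3 hdet fun x => ?_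
  have hD := ratFunc_linear_ne_zero (ne_zero_or_ne_zero_of_det hdet)
  have hLD := (eq_div_iff hD).1 hL
  set D := RatFunc.C c * RatFunc.X + RatFunc.C d with hDdef
  set N := RatFunc.C a * RatFunc.X + RatFunc.C b with hNdef
  have hw' : RatFunc.C w₂ - RatFunc.C w₁ ≠ 0 := sub_ne_zero.2 (RatFunc.C_injective.ne hw.symm)
  have hv' : RatFunc.C (-v) ≠ 0 := (_root_.map_ne_zero RatFunc.C).2 (neg_ne_zero.2 hv)
  have key : RatFunc.C ((2 * s + 1) ^ 3) * (RatFunc.X - RatFunc.C s) * L ^ 2 *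
        (L - RatFunc.C ((2 * t + 1) * (t + 2))) =
      RatFunc.C ((2 * t + 1) ^ 3) * (L - RatFunc.C t) * RatFunc.X ^ 2 *
        (RatFunc.X - RatFunc.C ((2 * s + 1) * (s + 2))) := by
    refine mul_left_cancel₀ (mul_ne_zero hv' hw') ?_
    generalize hM.subst f = g at h h'
    generalize RatFunc.C (-v) = v' at *
    generalize RatFunc.C ((2 * s + 1) ^ 3) = σ at *
    generalize RatFunc.C ((2 * t + 1) ^ 3) = τ at *
    generalize RatFunc.C ((2 * s + 1) * (s + 2)) = B at *
    generalize RatFunc.C ((2 * t + 1) * (t + 2)) = B' at *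
    linear_combination (v' * L ^ 2 * (L - B') - τ * (L - RatFunc.C t)) * h -
      (v' * RatFunc.X ^ 2 * (RatFunc.X - B) - σ * (RatFunc.X - RatFunc.C s)) * h'
  have key2 : RatFunc.C ((2 * s + 1) ^ 3) * (RatFunc.X - RatFunc.C s) * N ^ 2 *
        (N - RatFunc.C ((2 * t + 1) * (t + 2)) * D) =
      RatFunc.C ((2 * t + 1) ^ 3) * (N - RatFunc.C t * D) * D ^ 2 * RatFunc.X ^ 2 *
        (RatFunc.X - RatFunc.C ((2 * s + 1) * (s + 2))) := by
    rw [← hLD]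
    linear_combination D ^ 3 * key
  rw [hDdef, hNdef, ← algebraMap_linear, ← algebraMap_linear] at key2
  simp only [← RatFunc.algebraMap_C, ← RatFunc.algebraMap_X, ← map_mul, ← map_sub,
    ← map_pow] at key2
  have := congrArg (eval x) (RatFunc.algebraMap_injective ℝ key2)
  simpa using this

/-- The map `x ↦ (x - 1)(x + 3)³ / x³` is injective on each half-line. -/
theorem quartic_root_unique {μ x y : ℝ} (hxy : 0 < x * y)
    (hx : x ^ 4 + 8 * x ^ 3 + 18 * x ^ 2 - 27 - μ * x ^ 3 = 0)
    (hy : y ^ 4 + 8 * y ^ 3 + 18 * y ^ 2 - 27 - μ * y ^ 3 = 0) : x = y := by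
  by_contra hne
  have hsq : 0 < (x - y) ^ 2 := by positivity [sub_ne_zero.2 hne]
  have h : (x - y) * ((x * y) ^ 3 - 18 * (x * y) ^ 2 + 27 * (x ^ 2 + x * y + y ^ 2)) = 0 := by
    linear_combination y ^ 3 * hx - x ^ 3 * hy
  rcases mul_eq_zero.1 h with h | h
  · exact hne (sub_eq_zero.1 h)
  · have : 0 ≤ x * y * (x * y - 9) ^ 2 := by positivity
    linarith [show (x * y) ^ 3 - 18 * (x * y) ^ 2 + 27 * (x ^ 2 + x * y + y ^ 2) =
      x * y * (x * y - 9) ^ 2 + 27 * (x - y) ^ 2 by ring]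

theorem exists_pos_quartic_root (μ : ℝ) :
    ∃ x, 0 < x ∧ x ^ 4 + 8 * x ^ 3 + 18 * x ^ 2 - 27 - μ * x ^ 3 = 0 := by
  have hT : 2 ≤ |8 - μ| + 2 := by linarith [abs_nonneg (8 - μ)]
  have hμ : 2 ≤ |8 - μ| + 2 + 8 - μ := by linarith [neg_abs_le (8 - μ)]
  generalize |8 - μ| + 2 = T at hT hμ
  have hcont : ContinuousOn (fun x : ℝ => x ^ 4 + 8 * x ^ 3 + 18 * x ^ 2 - 27 - μ * x ^ 3)
    (Set.Icc 0 T) := by fun_prop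
  obtain ⟨x, hx, h⟩ := intermediate_value_Icc (by linarith) hcont
    (show (0 : ℝ) ∈ _ by
      refine ⟨by norm_num, ?_⟩
      have : 0 ≤ T ^ 3 * (T + 8 - μ) := by positivity [show 0 ≤ T + 8 - μ by linarith]
      nlinarith)
  refine ⟨x, lt_of_le_of_ne hx.1 ?_, h⟩
  rintro rfl
  norm_num at h

theorem exists_neg_quartic_root (μ : ℝ) :
    ∃ x, x < 0 ∧ x ^ 4 + 8 * x ^ 3 + 18 * x ^ 2 - 27 - μ * x ^ 3 = 0 := by
  obtain ⟨x, hx, h⟩ := exists_pos_quartic_root (16 - μ)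
  exact ⟨-x, by linarith, by linear_combination h⟩

theorem ncard_param_eq_two {m n : ℝ} (hn : n ≠ 0) :
    {s : ℝ | n * (s * (s + 2) ^ 3) = m * (2 * s + 1) ^ 3}.ncard = 2 := by
  obtain ⟨x, hx, hx0⟩ := exists_pos_quartic_root (16 * m / n)
  obtain ⟨y, hy, hy0⟩ := exists_neg_quartic_root (16 * m / n)
  have hiff (s : ℝ) : n * (s * (s + 2) ^ 3) = m * (2 * s + 1) ^ 3 ↔
      (2 * s + 1) ^ 4 + 8 * (2 * s + 1) ^ 3 + 18 * (2 * s + 1) ^ 2 - 27 -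
        16 * m / n * (2 * s + 1) ^ 3 = 0 := by
    field_simp
    constructor <;> intro h
    · linear_combination 16 * h
    · linear_combination h / 16
  rw [Set.ncard_eq_two]
  refine ⟨(x - 1) / 2, (y - 1) / 2, fun h => by linarith, ?_⟩
  ext s
  simp only [Set.mem_ofPred_eq, Set.mem_insert_iff, Set.mem_singleton_iff, hiff]
  constructor
  · intro h
    rcases lt_trichotomy (2 * s + 1) 0 with h1 | h1 | h1
    · right
      linarith [quartic_root_unique (mul_pos_of_neg_of_neg h1 hy) h hy0]
    · rw [h1] at h
      norm_num at h
    · left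
      linarith [quartic_root_unique (mul_pos h1 hx) h hx0]
  · rintro (rfl | rfl)
    · convert hx0 using 2 <;> ring
    · convert hy0 using 2 <;> ring

theorem exists_num_denom_eq {p q : ℝ[X]} (hpq : IsCoprime p q) (hq : q ≠ 0) :
    ∃ c : ℝ, c ≠ 0 ∧
      (algebraMap ℝ[X] (RatFunc ℝ) p / algebraMap ℝ[X] (RatFunc ℝ) q).num = C c * p ∧
      (algebraMap ℝ[X] (RatFunc ℝ) p / algebraMap ℝ[X] (RatFunc ℝ) q).denom = C c * q := by
  have hg : gcd p q = 1 := by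
    rw [← normalize_gcd]
    exact normalize_eq_one.2 ((gcd_isUnit_iff p q).2 hpq)
  refine ⟨q.leadingCoeff⁻¹, inv_ne_zero (leadingCoeff_ne_zero.2 hq), ?_, ?_⟩
  · simp [RatFunc.num_div, hg]
  · simp [RatFunc.denom_div _ hq, hg]

/-- Genericity may be checked on any coprime representation. -/
theorem genericDegR_div {n : ℕ} {Cv : Set ℝ} {p q : ℝ[X]} (hpq : IsCoprime p q) (hq : q ≠ 0)
    (hdeg : max p.natDegree q.natDegree = n)
    (hW : (derivative p * q - p * derivative q).natDegree = 2 * n - 2)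
    (hW0 : ∀ z : ℂ, aeval z (derivative p * q - p * derivative q) = 0 → aeval z q ≠ 0)
    (hval : {w : ℂ | ∃ z : ℂ, aeval z (derivative p * q - p * derivative q) = 0 ∧
      aeval z p / aeval z q = w} = Complex.ofReal '' Cv) :
    GenericDegR n Cv (algebraMap ℝ[X] (RatFunc ℝ) p / algebraMap ℝ[X] (RatFunc ℝ) q) := by
  obtain ⟨c, hc, hnum, hdenom⟩ := exists_num_denom_eq hpq hq
  have hWr : wronskian' (algebraMap ℝ[X] (RatFunc ℝ) p / algebraMap ℝ[X] (RatFunc ℝ) q) =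
      C (c ^ 2) * (derivative p * q - p * derivative q) := by
    simp only [wronskian', hnum, hdenom, derivative_C_mul, C_pow]
    ring
  have hc' : (c : ℂ) ≠ 0 := by exact_mod_cast hc
  have hroot (z : ℂ) : aeval z (C (c ^ 2) * (derivative p * q - p * derivative q)) = 0 ↔
      aeval z (derivative p * q - p * derivative q) = 0 := by
    rw [map_mul, aeval_C]
    simp [hc]
  have hquot (z : ℂ) : aeval z (C c * p) / aeval z (C c * q) = aeval z p / aeval z q := by
    simp only [map_mul, aeval_C, Complex.coe_algebraMap]
    exact mul_div_mul_left _ _ hc'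
  refine ⟨?_, ?_, fun z hz => ?_, ?_⟩
  · rw [hnum, hdenom, natDegree_C_mul hc, natDegree_C_mul hc, hdeg]
  · rw [hWr, natDegree_C_mul (pow_ne_zero 2 hc), hW]
  · rw [hWr, hroot] at hz
    rw [hdenom, map_mul, aeval_C]
    exact mul_ne_zero hc' (hW0 z hz)
  · rw [hWr, hnum, hdenom]
    simp only [hroot, hquot, hval]

/-- For every admissible parameter there is a generic function of degree `3` with the
corresponding normal form. -/
theorem exists_generic_hasNormalForm {w₁ w₂ w₃ w₄ κ s : ℝ} (h12 : w₁ ≠ w₂) (hκ : κ ≠ 0)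
    (hs : s ≠ 0) (hs' : s ≠ -1)
    (h3 : -κ * (s * (s + 2) ^ 3) * (w₃ - w₂) = w₃ - w₁)
    (h4 : -κ * (2 * s + 1) ^ 3 * (w₄ - w₂) = w₄ - w₁) :
    ∃ f, GenericDegR 3 {w₁, w₂, w₃, w₄} f ∧
      HasNormalForm w₁ w₂ (-κ * (2 * s + 1) ^ 3) s f := by
  have hs1 : s + 1 ≠ 0 := fun h => hs' (by linear_combination h)
  have hw : w₁ - w₂ ≠ 0 := sub_ne_zero.2 h12
  obtain ⟨P, hP⟩ : ∃ P : ℝ[X], P = C κ * (C s * X + 1) ^ 2 * (1 - C (2 * (s + 1) ^ 2) * X) :=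
    ⟨_, rfl⟩
  obtain ⟨p, hp⟩ : ∃ p : ℝ[X], p = C w₁ * X ^ 2 - C w₂ * P := ⟨_, rfl⟩
  obtain ⟨q, hq⟩ : ∃ q : ℝ[X], q = X ^ 2 - P := ⟨_, rfl⟩
  have hPdeg : P.natDegree = 3 := by
    have : P = C (-2 * κ * s ^ 2 * (s + 1) ^ 2) * X ^ 3 + C (κ * s ^ 2 - 4 * κ * s * (s + 1) ^ 2) *
        X ^ 2 + C (2 * κ * s - 2 * κ * (s + 1) ^ 2) * X + C κ := by
      rw [hP]
      simp only [map_mul, map_add, map_sub, map_pow, map_neg, map_one, map_ofNat]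
      ring
    rw [this]
    exact natDegree_cubic (by simp [hκ, hs, hs1])
  have hqdeg : q.natDegree = 3 := by
    rw [hq, natDegree_sub_eq_right_of_natDegree_lt] <;> simp [hPdeg]
  have hpdeg : p.natDegree ≤ 3 := by
    rw [hp]
    refine (natDegree_sub_le _ _).trans (max_le ?_ ?_)
    · exact (natDegree_C_mul_X_pow_le _ _).trans (by norm_num)
    · exact (natDegree_C_mul_le _ _).trans hPdeg.le
  have hq0 : q ≠ 0 := by
    rintro h
    simp [h] at hqdeg
  have hcopr : IsCoprime P (X ^ 2) := by
    refine IsCoprime.pow_right ?_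
    refine ⟨C κ⁻¹, -C κ⁻¹ * (C κ * (C s ^ 2 * X + 2 * C s) * (1 - C (2 * (s + 1) ^ 2) * X) -
      C κ * C (2 * (s + 1) ^ 2)), ?_⟩
    have : C κ⁻¹ * C κ = 1 := by rw [← C_mul, inv_mul_cancel₀ hκ, C_1]
    rw [hP]
    linear_combination this
  have hpq : IsCoprime p q := by
    obtain ⟨u, v, huv⟩ := hcopr
    have : C (w₁ - w₂)⁻¹ * (C w₁ - C w₂) = 1 := by
      rw [← C_sub, ← C_mul, inv_mul_cancel₀ hw, C_1]
    refine ⟨C (w₁ - w₂)⁻¹ * (u + v), -C (w₁ - w₂)⁻¹ * (C w₁ * u + C w₂ * v), ?_⟩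
    rw [hp, hq]
    linear_combination huv + (u * P + v * X ^ 2) * this
  have hW : derivative p * q - p * derivative q = C (-2 * κ * (w₁ - w₂)) *
      (X * (C s * X + C 1) * (C (s * (s + 1)) * X + C (-1)) * (C (s + 1) * X + C (-1))) := by
    rw [hp, hq, hP]
    simp only [derivative_mul, derivative_sub, derivative_add, derivative_pow, derivative_C,
      derivative_X, derivative_one]
    simp only [map_mul, map_add, map_sub, map_pow, map_neg, map_one, map_ofNat]
    push_cast
    simp only [map_ofNat]
    ring
  have hWdeg : (derivative p * q - p * derivative q).natDegree = 2 * 3 - 2 := by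
    rw [hW, natDegree_C_mul (by simp [hκ, hw])]
    have hss : s * (s + 1) ≠ 0 := mul_ne_zero hs hs1
    have hlin {a b : ℝ} (ha : a ≠ 0) : C a * X + C b ≠ 0 := fun h => by
      simpa [h] using natDegree_linear (b := b) ha
    rw [natDegree_mul (mul_ne_zero (mul_ne_zero X_ne_zero (hlin hs)) (hlin hss)) (hlin hs1),
      natDegree_mul (mul_ne_zero X_ne_zero (hlin hs)) (hlin hss),
      natDegree_mul X_ne_zero (hlin hs), natDegree_linear hs, natDegree_linear hss,
      natDegree_linear hs1, natDegree_X]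
  have hroot (z : ℂ) : aeval z (derivative p * q - p * derivative q) = 0 ↔
      z = 0 ∨ s * z + 1 = 0 ∨ s * (s + 1) * z = 1 ∨ (s + 1) * z = 1 := by
    have hk : (algebraMap ℝ ℂ (-2 * κ * (w₁ - w₂))) ≠ 0 :=
      (_root_.map_ne_zero _).2 (mul_ne_zero (mul_ne_zero (by norm_num) hκ) hw)
    rw [hW, map_mul, aeval_C, mul_eq_zero_iff_left hk]
    simp [mul_eq_zero, ← sub_eq_add_neg, sub_eq_zero, or_assoc]
  have hev (z : ℂ) : aeval z P = κ * (s * z + 1) ^ 2 * (1 - 2 * (s + 1) ^ 2 * z) := by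
    simp [hP]
  have hpz (z : ℂ) : aeval z p = w₁ * z ^ 2 - w₂ * aeval z P := by
    simp [hp]
  have hqz (z : ℂ) : aeval z q = z ^ 2 - aeval z P := by
    simp [hq]
  have hκ' : (κ : ℂ) ≠ 0 := by exact_mod_cast hκ
  have hw' : (w₁ - w₂ : ℂ) ≠ 0 := by exact_mod_cast hw
  have h3' : -κ * (s * (s + 2) ^ 3) * (w₃ - w₂) = (w₃ - w₁ : ℂ) := by exact_mod_cast h3
  have h4' : -κ * (2 * s + 1) ^ 3 * (w₄ - w₂) = (w₄ - w₁ : ℂ) := by exact_mod_cast h4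
  have hs0 : (s : ℂ) ≠ 0 := by exact_mod_cast hs
  have hs1' : (s + 1 : ℂ) ≠ 0 := by exact_mod_cast hs1
  have val {z : ℂ} {r w : ℝ} (hz : z ≠ 0) (hPz : aeval z P = r * z ^ 2)
      (hr : r * (w - w₂) = w - w₁) : aeval z q ≠ 0 ∧ aeval z p / aeval z q = w := by
    have hr' : r * (w - w₂) = (w - w₁ : ℂ) := by exact_mod_cast hr
    have hq0 : aeval z q ≠ 0 := fun h0 => mul_ne_zero hw' (pow_ne_zero 2 hz) (by
      rw [hqz, hPz] at h0
      linear_combination (w - w₂ : ℂ) * h0 + z ^ 2 * hr')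
    refine ⟨hq0, (div_eq_iff hq0).2 ?_⟩
    rw [hpz, hqz, hPz]
    linear_combination z ^ 2 * hr'
  have val₁ {z : ℂ} (hz : s * z + 1 = 0) : aeval z q ≠ 0 ∧ aeval z p / aeval z q = w₁ := by
    refine val (r := 0) ?_ ?_ (by simp)
    · rintro rfl
      simp at hz
    · simp [hev, hz]
  have val₂ {z : ℂ} (hz : z = 0) : aeval z q ≠ 0 ∧ aeval z p / aeval z q = w₂ := by
    subst hz
    simp [hpz, hqz, hev, hκ']
  have val₃ {z : ℂ} (hz : s * (s + 1) * z = 1) :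
      aeval z q ≠ 0 ∧ aeval z p / aeval z q = w₃ := by
    refine val (r := -κ * (s * (s + 2) ^ 3)) ?_ ?_ h3
    · rintro rfl
      simp at hz
    · rw [hev, show s * z + 1 = s * (s + 2) * z by linear_combination -hz,
        show 1 - 2 * (s + 1) ^ 2 * z = -((s + 1) * (s + 2) * z) by linear_combination -hz]
      push_cast
      linear_combination -(κ * s * (s + 2) ^ 3 * z ^ 2) * hz
  have val₄ {z : ℂ} (hz : (s + 1) * z = 1) : aeval z q ≠ 0 ∧ aeval z p / aeval z q = w₄ := by
    refine val (r := -κ * (2 * s + 1) ^ 3) ?_ ?_ h4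
    · rintro rfl
      simp at hz
    · rw [hev, show s * z + 1 = (2 * s + 1) * z by linear_combination -hz,
        show 1 - 2 * (s + 1) ^ 2 * z = -((s + 1) * (2 * s + 1) * z) by linear_combination -hz]
      push_cast
      linear_combination -(κ * (2 * s + 1) ^ 3 * z ^ 2) * hz
  refine ⟨algebraMap ℝ[X] (RatFunc ℝ) p / algebraMap ℝ[X] (RatFunc ℝ) q,
    genericDegR_div hpq hq0 (by rw [hqdeg, max_eq_right hpdeg]) hWdeg (fun z hz => ?_) ?_, ?_⟩
  · rcases (hroot z).1 hz with h | h | h | h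
    exacts [(val₂ h).1, (val₁ h).1, (val₃ h).1, (val₄ h).1]
  · ext w
    simp only [hroot, Set.mem_ofPred_eq, Set.image_insert_eq, Set.image_singleton,
      Set.mem_insert_iff, Set.mem_singleton_iff]
    constructor
    · rintro ⟨z, h | h | h | h, rfl⟩
      · exact Or.inr (Or.inl (val₂ h).2)
      · exact Or.inl (val₁ h).2
      · exact Or.inr (Or.inr (Or.inl (val₃ h).2))
      · exact Or.inr (Or.inr (Or.inr (val₄ h).2))
    · rintro (rfl | rfl | rfl | rfl)
      · have h : s * (-1 / s : ℂ) + 1 = 0 := by field_simp; ring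
        exact ⟨_, Or.inr (Or.inl h), (val₁ h).2⟩
      · exact ⟨0, Or.inl rfl, (val₂ rfl).2⟩
      · have h : s * (s + 1) * (1 / (s * (s + 1)) : ℂ) = 1 := by field_simp
        exact ⟨_, Or.inr (Or.inr (Or.inl h)), (val₃ h).2⟩
      · have h : (s + 1) * (1 / (s + 1) : ℂ) = 1 := by field_simp
        exact ⟨_, Or.inr (Or.inr (Or.inr h)), (val₄ h).2⟩
  · refine ⟨(RatFunc.C s * RatFunc.X + RatFunc.C 1) / (RatFunc.C 1 * RatFunc.X + RatFunc.C 0),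
      ⟨s, 1, 1, 0, by simp, rfl⟩, ?_⟩
    have hX : (RatFunc.X : RatFunc ℝ) ≠ 0 := RatFunc.X_ne_zero
    have hq0' := RatFunc.algebraMap_ne_zero hq0
    have hpq' : algebraMap ℝ[X] (RatFunc ℝ) p =
        RatFunc.C w₁ * RatFunc.X ^ 2 - RatFunc.C w₂ * algebraMap ℝ[X] (RatFunc ℝ) P := by
      rw [hp]
      simp only [map_sub, map_mul, map_pow, RatFunc.algebraMap_C, RatFunc.algebraMap_X]
    have hqq : algebraMap ℝ[X] (RatFunc ℝ) q =
        RatFunc.X ^ 2 - algebraMap ℝ[X] (RatFunc ℝ) P := by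
      rw [hq]
      simp only [map_sub, map_pow, RatFunc.algebraMap_X]
    have hPP : algebraMap ℝ[X] (RatFunc ℝ) P = RatFunc.C κ * (RatFunc.C s * RatFunc.X + 1) ^ 2 *
        (1 - 2 * (RatFunc.C s + 1) ^ 2 * RatFunc.X) := by
      rw [hP]
      simp only [map_sub, map_add, map_mul, map_pow, map_one, map_ofNat, RatFunc.algebraMap_C,
        RatFunc.algebraMap_X]
    have e₁ : algebraMap ℝ[X] (RatFunc ℝ) p / algebraMap ℝ[X] (RatFunc ℝ) q - RatFunc.C w₁ =
        (RatFunc.C w₁ - RatFunc.C w₂) * algebraMap ℝ[X] (RatFunc ℝ) P /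
          algebraMap ℝ[X] (RatFunc ℝ) q := by
      rw [eq_div_iff hq0', sub_mul, div_mul_cancel₀ _ hq0', hpq', hqq]
      ring
    have e₂ : algebraMap ℝ[X] (RatFunc ℝ) p / algebraMap ℝ[X] (RatFunc ℝ) q - RatFunc.C w₂ =
        (RatFunc.C w₁ - RatFunc.C w₂) * RatFunc.X ^ 2 / algebraMap ℝ[X] (RatFunc ℝ) q := by
      rw [eq_div_iff hq0', sub_mul, div_mul_cancel₀ _ hq0', hpq', hqq]
      ring
    rw [e₁, e₂, hPP]
    simp only [map_mul, map_add, map_neg, map_pow, map_one, map_zero, map_ofNat, one_mul, add_zero]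
    field_simp
    ring

/-- A nonzero real polynomial of degree at most `3` has only real multiple roots. -/
theorem im_eq_zero_of_double_root {r : ℝ[X]} (hr : r.natDegree ≤ 3) (hr0 : r ≠ 0) {z : ℂ}
    (hz : aeval z r = 0) (hz' : aeval z (derivative r) = 0) : z.im = 0 := by
  by_contra hy
  have hd : (derivative r).natDegree < 3 := by
    have := natDegree_derivative_le r
    omega
  rw [aeval_eq_sum_range' (Nat.lt_succ_of_le hr)] at hz
  rw [aeval_eq_sum_range' hd] at hz'
  simp only [Finset.sum_range_succ, Finset.sum_range_zero, coeff_derivative] at hz hz'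
  obtain ⟨x, y⟩ := z
  simp only [Complex.ext_iff, Complex.add_re, Complex.add_im, Complex.real_smul, Complex.mul_re,
    Complex.mul_im, Complex.ofReal_re, Complex.ofReal_im, pow_succ, pow_zero, Complex.one_re,
    Complex.one_im, Complex.zero_re, Complex.zero_im] at hz hz' hy
  obtain ⟨h1, h2⟩ := hz
  obtain ⟨h3, h4⟩ := hz'
  norm_num at h1 h2 h3 h4
  have h5 : 3 * r.coeff 3 * x + r.coeff 2 = 0 :=
    mul_left_cancel₀ hy (by linear_combination h4 / 2)
  have h6 : r.coeff 3 * (3 * x ^ 2 - y ^ 2) + 2 * r.coeff 2 * x + r.coeff 1 = 0 :=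
    mul_left_cancel₀ hy (by linear_combination h2)
  have c3 : r.coeff 3 = 0 :=
    mul_left_cancel₀ (pow_ne_zero 2 hy) (by linear_combination (h6 - h3) / 2)
  have c2 : r.coeff 2 = 0 := by linear_combination h5 - 3 * x * c3
  have c1 : r.coeff 1 = 0 := by
    linear_combination h6 - (3 * x ^ 2 - y ^ 2) * c3 - 2 * x * c2
  have c0 : r.coeff 0 = 0 := by
    rw [c1, c2, c3] at h1
    simpa using h1
  refine hr0 (ext fun n => ?_)
  match n with
  | 0 => simpa
  | 1 => simpa
  | 2 => simpa
  | 3 => simpa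
  | n + 4 => simpa using coeff_eq_zero_of_natDegree_lt (by omega)

/-- The critical points with real critical values are real for a function of degree `3`. -/
theorem exists_real_critical_point {p q : ℝ[X]} (hp : p.natDegree ≤ 3) (hq : q.natDegree ≤ 3)
    (hW : derivative p * q - p * derivative q ≠ 0) {z : ℂ} {w : ℝ}
    (hWz : aeval z (derivative p * q - p * derivative q) = 0) (hqz : aeval z q ≠ 0)
    (hw : aeval z p / aeval z q = w) :
    ∃ x : ℝ, eval x p = w * eval x q ∧ eval x q ≠ 0 ∧
      eval x (derivative p) = w * eval x (derivative q) := by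
  have hw' := (div_eq_iff hqz).1 hw
  have hr : aeval z (p - C w * q) = 0 := by simp [hw']
  have hr' : aeval z (derivative (p - C w * q)) = 0 := by
    refine mul_left_cancel₀ hqz ?_
    simp only [derivative_C_mul, map_sub, map_mul, aeval_C,
      Complex.coe_algebraMap] at hWz ⊢
    linear_combination hWz + aeval z (derivative q) * hw'
  have him : z.im = 0 := by
    refine im_eq_zero_of_double_root ?_ (fun h0 => hW ?_) hr hr'
    · exact (natDegree_sub_le _ _).trans (max_le hp ((natDegree_C_mul_le _ _).trans hq))
    · rw [sub_eq_zero.1 h0, derivative_C_mul]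
      ring
  obtain ⟨x, rfl⟩ : ∃ x : ℝ, (x : ℂ) = z := ⟨z.re, Complex.ext rfl him.symm⟩
  have hev (r : ℝ[X]) : aeval (x : ℂ) r = (eval x r : ℝ) := by
    rw [← Complex.coe_algebraMap, aeval_algebraMap_apply, coe_aeval_eq_eval]
  simp only [hev, derivative_sub, derivative_C_mul, eval_sub, eval_mul, eval_C,
    Complex.ofReal_eq_zero, sub_eq_zero, ne_eq] at hr hr' hqz
  exact ⟨x, hr, hqz, hr'⟩

/-- Factorisation of a polynomial of degree at most `3` with a double root `x`; the remaining
linear factor is written in the basis `X - x₁`, `X - x₂`. -/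
theorem exists_eq_sq_mul_linear {r : ℝ[X]} (hr : r.natDegree ≤ 3) {x x₁ x₂ : ℝ} (hx : x₁ ≠ x₂)
    (h0 : eval x r = 0) (h1 : eval x (derivative r) = 0) :
    ∃ c d : ℝ, r = (X - C x) ^ 2 * (C c * (X - C x₁) + C d * (X - C x₂)) := by
  obtain ⟨m, rfl⟩ := dvd_iff_isRoot.2 h0
  have hm : eval x m = 0 := by simpa [derivative_mul] using h1
  obtain ⟨l, rfl⟩ := dvd_iff_isRoot.2 hm
  have hl : l.natDegree ≤ 1 := by
    rcases eq_or_ne l 0 with rfl | hl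
    · simp
    rw [natDegree_mul (X_sub_C_ne_zero x) (mul_ne_zero (X_sub_C_ne_zero x) hl),
      natDegree_mul (X_sub_C_ne_zero x) hl, natDegree_X_sub_C] at hr
    omega
  obtain ⟨a, b, rfl⟩ := exists_eq_X_add_C_of_natDegree_le_one hl
  have hx' := sub_ne_zero.2 hx
  refine ⟨-(a * x₂ + b) / (x₁ - x₂), (a * x₁ + b) / (x₁ - x₂), ?_⟩
  have ha : -(a * x₂ + b) / (x₁ - x₂) + (a * x₁ + b) / (x₁ - x₂) = a := by
    field_simp
    ring
  have hb : -(a * x₂ + b) / (x₁ - x₂) * x₁ + (a * x₁ + b) / (x₁ - x₂) * x₂ = -b := by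
    field_simp
    ring
  generalize -(a * x₂ + b) / (x₁ - x₂) = c at *
  generalize (a * x₁ + b) / (x₁ - x₂) = d at *
  have ha' := congrArg (C : ℝ → ℝ[X]) ha
  have hb' := congrArg (C : ℝ → ℝ[X]) hb
  simp only [map_add, map_mul, map_neg] at ha' hb'
  linear_combination -(X - C x) ^ 2 * (X * ha' - hb')

/-- The parameter of the normal form, computed from the coefficients of
`t ↦ t² (γ t + δ) / (α t + β)` and its critical points `t₃`, `t₄`. -/
theorem exists_param {α β γ δ t₃ t₄ v₃ v₄ : ℝ} (ht : t₃ ≠ t₄) (ht₃ : t₃ ≠ 0) (ht₄ : t₄ ≠ 0)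
    (h3 : 2 * α * γ * t₃ ^ 2 + (3 * β * γ + α * δ) * t₃ + 2 * β * δ = 0)
    (h4 : 2 * α * γ * t₄ ^ 2 + (3 * β * γ + α * δ) * t₄ + 2 * β * δ = 0)
    (hne : ¬ (α * γ = 0 ∧ 3 * β * γ + α * δ = 0 ∧ β * δ = 0))
    (hd₃ : α * t₃ + β ≠ 0) (hd₄ : α * t₄ + β ≠ 0)
    (hv₃ : v₃ * (α * t₃ + β) = t₃ ^ 2 * (γ * t₃ + δ))
    (hv₄ : v₄ * (α * t₄ + β) = t₄ ^ 2 * (γ * t₄ + δ)) :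
    ∃ s k : ℝ, k ≠ 0 ∧ β ≠ 0 ∧ γ ≠ 0 ∧ k * β = -s * α ∧
      (2 * s + 1) * (s + 2) * γ = -k * δ ∧
      (2 * s + 1) ^ 3 * s * γ = v₄ * k ^ 3 * β ∧
      v₄ * (s * (s + 2) ^ 3) = v₃ * (2 * s + 1) ^ 3 := by
  have hsum : 2 * α * γ * (t₃ + t₄) = -(3 * β * γ + α * δ) :=
    mul_left_cancel₀ (sub_ne_zero.2 ht) (by linear_combination h3 - h4)
  have hprod : α * γ * (t₃ * t₄) = β * δ := by linear_combination (t₃ * hsum - h3) / 2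
  have hαγ : α * γ ≠ 0 := fun h =>
    hne ⟨h, by linear_combination hsum - 2 * (t₃ + t₄) * h,
      by linear_combination -hprod + t₃ * t₄ * h⟩
  have hβδ : β * δ ≠ 0 := hprod ▸ mul_ne_zero hαγ (mul_ne_zero ht₃ ht₄)
  have hα := left_ne_zero_of_mul hαγ
  have hγ := right_ne_zero_of_mul hαγ
  have hβ := left_ne_zero_of_mul hβδ
  obtain ⟨s, hs⟩ : ∃ s, s = -2 - α * t₃ / β := ⟨_, rfl⟩
  obtain ⟨u, hu⟩ : ∃ u, u = -2 - α * t₄ / β := ⟨_, rfl⟩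
  have e₃ : α * t₃ = -(s + 2) * β := by rw [hs]; field_simp; ring
  have e₄ : α * t₄ = -(u + 2) * β := by rw [hu]; field_simp; ring
  have eδ : α * δ = β * γ * ((s + 2) * (u + 2)) := by
    refine mul_left_cancel₀ hβ ?_
    linear_combination -α * hprod + γ * α * t₄ * e₃ - γ * (s + 2) * β * e₄
  have hsu : s * u = 1 := by
    refine mul_left_cancel₀ (mul_ne_zero hβ hγ) ?_
    linear_combination hsum - eδ - 2 * γ * (e₃ + e₄)
  have hs0 : s ≠ 0 := left_ne_zero_of_mul_eq_one hsu
  have f₃ : v₃ * s * α ^ 3 = -(β ^ 2 * γ * (s + 2) ^ 3) := by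
    refine mul_left_cancel₀ hd₃ ?_
    have key : (α * t₃ + β) * (v₃ * s * α ^ 3) =
        s * ((α * t₃) ^ 2 * (γ * (α * t₃) + α * δ)) := by
      linear_combination s * α ^ 3 * hv₃
    rw [key, e₃, eδ]
    linear_combination β ^ 3 * γ * (s + 2) ^ 3 * hsu
  have f₄ : v₄ * s ^ 2 * α ^ 3 = -(β ^ 2 * γ * (2 * s + 1) ^ 3) := by
    refine mul_left_cancel₀ hd₄ ?_
    have key : (α * t₄ + β) * (v₄ * s ^ 2 * α ^ 3) =
        s ^ 2 * ((α * t₄) ^ 2 * (γ * (α * t₄) + α * δ)) := by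
      linear_combination s ^ 2 * α ^ 3 * hv₄
    have e₁ : s + 1 = s * (u + 1) := by linear_combination -hsu
    have e₂ : 2 * s + 1 = s * (u + 2) := by linear_combination -hsu
    rw [key, e₄, eδ, e₂]
    linear_combination β ^ 3 * γ * s ^ 2 * (u + 2) ^ 3 * e₁
  refine ⟨s, -s * α / β, ?_, hβ, hγ, ?_, ?_, ?_, ?_⟩
  · exact div_ne_zero (mul_ne_zero (neg_ne_zero.2 hs0) hα) hβ
  · field_simp
  · refine mul_left_cancel₀ hβ ?_
    field_simp
    linear_combination -s * eδ - β * γ * (s + 2) * hsu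
  · field_simp
    linear_combination f₄
  · refine mul_left_cancel₀ (mul_ne_zero hs0 (pow_ne_zero 3 hα)) ?_
    linear_combination (s + 2) ^ 3 * f₄ - (2 * s + 1) ^ 3 * f₃

/-- Each critical value of a generic function of degree `3` is attained at a real critical
point. -/
theorem GenericDegR.exists_real_critical_point {Cv : Set ℝ} {f : RatFunc ℝ}
    (hf : GenericDegR 3 Cv f) {w : ℝ} (hw : w ∈ Cv) :
    ∃ x : ℝ, eval x f.num = w * eval x f.denom ∧ eval x f.denom ≠ 0 ∧
      eval x (derivative f.num) = w * eval x (derivative f.denom) := by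
  obtain ⟨hdeg, hWdeg, hq, hval⟩ := hf
  have hW : wronskian' f ≠ 0 := fun h => by simp [h] at hWdeg
  obtain ⟨z, hz, hzw⟩ := hval.ge ⟨w, hw, rfl⟩
  exact _root_.exists_real_critical_point (hdeg ▸ le_max_left _ _) (hdeg ▸ le_max_right _ _) hW hz
    (hq z hz) hzw

/-- Every generic function of degree `3` has a normal form, whose parameter is a root of a quartic
determined by the critical values. -/
theorem GenericDegR.exists_hasNormalForm {w₁ w₂ w₃ w₄ : ℝ} (h12 : w₁ ≠ w₂) (h13 : w₁ ≠ w₃)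
    (h14 : w₁ ≠ w₄) (h23 : w₂ ≠ w₃) (h24 : w₂ ≠ w₄) (h34 : w₃ ≠ w₄) {f : RatFunc ℝ}
    (hf : GenericDegR 3 {w₁, w₂, w₃, w₄} f) :
    ∃ s : ℝ, (w₄ - w₁) / (w₄ - w₂) * (s * (s + 2) ^ 3) =
        (w₃ - w₁) / (w₃ - w₂) * (2 * s + 1) ^ 3 ∧
      HasNormalForm w₁ w₂ ((w₄ - w₁) / (w₄ - w₂)) s f := by
  have hw := sub_ne_zero.2 h12
  have hp : f.num.natDegree ≤ 3 := hf.1 ▸ le_max_left _ _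
  have hq : f.denom.natDegree ≤ 3 := hf.1 ▸ le_max_right _ _
  have hW : derivative f.num * f.denom - f.num * derivative f.denom ≠ 0 := fun h => by
    simpa [wronskian', h] using hf.2.1
  obtain ⟨z₁, hz₁, hqz₁, hz₁'⟩ := hf.exists_real_critical_point (w := w₁) (by simp)
  obtain ⟨z₂, hz₂, hqz₂, hz₂'⟩ := hf.exists_real_critical_point (w := w₂) (by simp)
  obtain ⟨x₃, hx₃, hqx₃, hx₃'⟩ := hf.exists_real_critical_point (w := w₃) (by simp)
  obtain ⟨x₄, hx₄, hqx₄, hx₄'⟩ := hf.exists_real_critical_point (w := w₄) (by simp)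
  have hne {x y w w' : ℝ} (hx : eval x f.num = w * eval x f.denom) (h0 : eval x f.denom ≠ 0)
      (hy : eval y f.num = w' * eval y f.denom) (h : w ≠ w') : x ≠ y := by
    rintro rfl
    exact h (mul_right_cancel₀ h0 (hx.symm.trans hy))
  have hz : z₁ ≠ z₂ := hne hz₁ hqz₁ hz₂ h12
  have hz' := sub_ne_zero.2 hz
  have hx₃₁ := sub_ne_zero.2 (hne hz₁ hqz₁ hx₃ h13).symm
  have hx₃₂ := sub_ne_zero.2 (hne hz₂ hqz₂ hx₃ h23).symm
  have hx₄₁ := sub_ne_zero.2 (hne hz₁ hqz₁ hx₄ h14).symm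
  have hx₄₂ := sub_ne_zero.2 (hne hz₂ hqz₂ hx₄ h24).symm
  have hx := sub_ne_zero.2 (hne hx₃ hqx₃ hx₄ h34)
  have hr (w : ℝ) : (f.num - C w * f.denom).natDegree ≤ 3 :=
    (natDegree_sub_le _ _).trans (max_le hp ((natDegree_C_mul_le _ _).trans hq))
  obtain ⟨γ, δ, h₁⟩ := exists_eq_sq_mul_linear (hr w₁) hz (x := z₁) (by simp [hz₁])
    (by simp [hz₁'])
  obtain ⟨α, β, h₂⟩ := exists_eq_sq_mul_linear (hr w₂) hz (x := z₂) (by simp [hz₂])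
    (by simp [hz₂'])
  have hWr : (C w₁ - C w₂) * (derivative f.num * f.denom - f.num * derivative f.denom) =
      (C z₁ - C z₂) * ((X - C z₁) * (X - C z₂)) *
        (C (α * γ) * (2 * (X - C z₁) ^ 2) + C (3 * β * γ + α * δ) * ((X - C z₁) * (X - C z₂)) +
          C (β * δ) * (2 * (X - C z₂) ^ 2)) := by
    have h₁' := congrArg derivative h₁
    have h₂' := congrArg derivative h₂
    have : (C w₁ - C w₂) * (derivative f.num * f.denom - f.num * derivative f.denom) =
        derivative (f.num - C w₁ * f.denom) * (f.num - C w₂ * f.denom) -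
          (f.num - C w₁ * f.denom) * derivative (f.num - C w₂ * f.denom) := by
      simp only [derivative_sub, derivative_C_mul]
      ring
    rw [this, h₁', h₂', h₁, h₂]
    simp only [derivative_mul, derivative_sub, derivative_pow, derivative_C,
      derivative_X, map_mul, map_add, map_ofNat]
    push_cast
    simp only [map_ofNat]
    ring
  have hcoef : ¬ (α * γ = 0 ∧ 3 * β * γ + α * δ = 0 ∧ β * δ = 0) := by
    rintro ⟨h, h', h''⟩
    rw [h, h', h''] at hWr
    simp only [map_zero, zero_mul, add_zero, mul_zero] at hWr
    exact mul_ne_zero (by rwa [← C_sub, ne_eq, C_eq_zero]) hW hWr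
  have hquad {x w : ℝ} (h0 : eval x f.num = w * eval x f.denom)
      (h1 : eval x (derivative f.num) = w * eval x (derivative f.denom)) (hx₁ : x - z₁ ≠ 0)
      (hx₂ : x - z₂ ≠ 0) : 2 * α * γ * ((x - z₁) / (x - z₂)) ^ 2 +
        (3 * β * γ + α * δ) * ((x - z₁) / (x - z₂)) + 2 * β * δ = 0 := by
    have := congrArg (eval x) hWr
    simp only [eval_mul, eval_sub, eval_add, eval_pow, eval_C, eval_X, eval_ofNat, h0, h1] at this
    have h := mul_left_cancel₀ (mul_ne_zero hz' (mul_ne_zero hx₁ hx₂))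
      (this.symm.trans (by ring : _ = (z₁ - z₂) * ((x - z₁) * (x - z₂)) * 0))
    field_simp
    linear_combination h
  have hden {x w : ℝ} (h0 : eval x f.num = w * eval x f.denom) (hqx : eval x f.denom ≠ 0)
      (hw : w₂ ≠ w) (hx₂ : x - z₂ ≠ 0) : α * ((x - z₁) / (x - z₂)) + β ≠ 0 ∧
        (w - w₁) / (w - w₂) * (α * ((x - z₁) / (x - z₂)) + β) =
          ((x - z₁) / (x - z₂)) ^ 2 * (γ * ((x - z₁) / (x - z₂)) + δ) := by
    have e₁ := congrArg (eval x) h₁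
    have e₂ := congrArg (eval x) h₂
    simp only [eval_mul, eval_sub, eval_add, eval_pow, eval_C, eval_X, h0] at e₁ e₂
    have hw' := sub_ne_zero.2 hw.symm
    constructor
    · intro h
      refine mul_ne_zero hw' hqx ?_
      field_simp at h
      linear_combination e₂ + (x - z₂) ^ 2 * h
    · field_simp
      linear_combination (w - w₂) * e₁ - (w - w₁) * e₂
  obtain ⟨hd₃, hv₃⟩ := hden hx₃ hqx₃ h23 hx₃₂
  obtain ⟨hd₄, hv₄⟩ := hden hx₄ hqx₄ h24 hx₄₂
  have ht : (x₃ - z₁) / (x₃ - z₂) ≠ (x₄ - z₁) / (x₄ - z₂) := by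
    rw [ne_eq, div_eq_div_iff hx₃₂ hx₄₂]
    exact fun h => mul_ne_zero hz' hx (by linear_combination h)
  obtain ⟨s, k, hk, hβ, hγ, e₁, e₂, e₃, e₄⟩ := exists_param ht (div_ne_zero hx₃₁ hx₃₂)
    (div_ne_zero hx₄₁ hx₄₂) (hquad hx₃ hx₃' hx₃₁ hx₃₂) (hquad hx₄ hx₄' hx₄₁ hx₄₂) hcoef hd₃ hd₄
    hv₃ hv₄
  generalize (w₄ - w₁) / (w₄ - w₂) = v at *
  refine ⟨s, e₄, (RatFunc.C k * RatFunc.X + RatFunc.C (-k * z₁)) /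
    (RatFunc.C 1 * RatFunc.X + RatFunc.C (-z₂)), ⟨k, -k * z₁, 1, -z₂, ?_, rfl⟩, ?_⟩
  · exact fun h => mul_ne_zero hk hz' (by linear_combination h)
  have hQ := RatFunc.algebraMap_ne_zero f.denom_ne_zero
  have hB : RatFunc.X - RatFunc.C z₂ ≠ 0 := by
    have := RatFunc.algebraMap_ne_zero (X_sub_C_ne_zero z₂)
    simpa using this
  have hf' (w : ℝ) : f - RatFunc.C w = algebraMap ℝ[X] (RatFunc ℝ) (f.num - C w * f.denom) /
      algebraMap ℝ[X] (RatFunc ℝ) f.denom := by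
    rw [map_sub, map_mul, RatFunc.algebraMap_C, sub_div, mul_div_cancel_right₀ _ hQ,
      RatFunc.num_div_denom]
  have key : C ((2 * s + 1) ^ 3) * (C k * (X - C z₁) - C s * (X - C z₂)) *
      (C γ * (X - C z₁) + C δ * (X - C z₂)) = C (-v) * C k ^ 2 *
      (C k * (X - C z₁) - C ((2 * s + 1) * (s + 2)) * (X - C z₂)) *
      (C α * (X - C z₁) + C β * (X - C z₂)) := by
    have c₁ : C k * C β = -C s * C α := by simpa using congrArg (C : ℝ → ℝ[X]) e₁
    have c₂ : C ((2 * s + 1) * (s + 2)) * C γ = -C k * C δ := by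
      simpa only [map_mul, map_neg] using congrArg (C : ℝ → ℝ[X]) e₂
    have c₃ : C ((2 * s + 1) ^ 3) * C s * C γ = C v * C k ^ 3 * C β := by
      simpa only [map_mul, map_pow] using congrArg (C : ℝ → ℝ[X]) e₃
    have d₁ : C β * (C k * (X - C z₁) - C s * (X - C z₂)) =
        -C s * (C α * (X - C z₁) + C β * (X - C z₂)) := by
      linear_combination (X - C z₁) * c₁
    have d₂ : C γ * (C k * (X - C z₁) - C ((2 * s + 1) * (s + 2)) * (X - C z₂)) =
        C k * (C γ * (X - C z₁) + C δ * (X - C z₂)) := by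
      linear_combination -(X - C z₂) * c₂
    refine mul_left_cancel₀ (mul_ne_zero (C_ne_zero.2 hβ) (C_ne_zero.2 hγ)) ?_
    generalize C k * (X - C z₁) - C s * (X - C z₂) = U at *
    generalize C k * (X - C z₁) - C ((2 * s + 1) * (s + 2)) * (X - C z₂) = V at *
    generalize C γ * (X - C z₁) + C δ * (X - C z₂) = M at *
    generalize C α * (X - C z₁) + C β * (X - C z₂) = N at *
    rw [C_neg]
    linear_combination C ((2 * s + 1) ^ 3) * C γ * M * d₁ + C v * C k ^ 2 * C β * N * d₂ -
      M * N * c₃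
  have key' := congrArg (algebraMap ℝ[X] (RatFunc ℝ)) key
  rw [hf', hf', h₁, h₂]
  simp only [map_mul, map_sub, map_add, map_pow, map_neg, map_one, RatFunc.algebraMap_C,
    RatFunc.algebraMap_X] at key' ⊢
  generalize RatFunc.C z₁ = Z₁ at *
  generalize RatFunc.C z₂ = Z₂ at *
  generalize RatFunc.C (_ : ℝ) = S at *
  rw [one_mul, ← sub_eq_add_neg]
  field_simp
  linear_combination (RatFunc.X - Z₁) ^ 2 * key'

/-- The degenerate parameters are not roots of that quartic. -/
theorem param_nondegenerate {m n s : ℝ} (hm : m ≠ 0) (hn : n ≠ 0) (hmn : m ≠ n)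
    (h : n * (s * (s + 2) ^ 3) = m * (2 * s + 1) ^ 3) :
    s ≠ 0 ∧ s ≠ -1 ∧ 2 * s + 1 ≠ 0 ∧ s * (s + 2) ^ 3 ≠ (2 * s + 1) ^ 3 := by
  have h2 : 2 * s + 1 ≠ 0 := fun h0 => by
    obtain rfl : s = -1 / 2 := by linear_combination h0 / 2
    norm_num at h
    exact hn h
  have h3 : s * (s + 2) ^ 3 ≠ (2 * s + 1) ^ 3 := fun h0 =>
    hmn (mul_right_cancel₀ (pow_ne_zero 3 h2) (by rw [← h, h0]))
  refine ⟨?_, ?_, h2, h3⟩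
  · rintro rfl
    simp at h
    exact hm h.symm
  · rintro rfl
    norm_num at h3

/-- For every set `C` of `4` distinct real numbers, the number of real
Möbius-equivalence classes of generic degree-`3` real rational M-functions with
critical value set `C` equals `2`. -/
theorem count_real_rational_M_functions_degree_3
    (Cv : Set ℝ) (hC : Cv.ncard = 4) :
    Nat.card (Quot fun f g : {f : RatFunc ℝ // GenericDegR 3 Cv f} =>
        MobiusEquiv f.1 g.1) = 2 := by
  obtain ⟨w₁, T, h₁, rfl, hT⟩ := Set.eq_insert_of_ncard_eq_succ hC
  obtain ⟨w₂, w₃, w₄, h23, h24, h34, rfl⟩ := Set.ncard_eq_three.1 hT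
  simp only [Set.mem_insert_iff, Set.mem_singleton_iff, not_or] at h₁
  obtain ⟨h12, h13, h14⟩ := h₁
  have d31 := sub_ne_zero.2 (Ne.symm h13)
  have d41 := sub_ne_zero.2 (Ne.symm h14)
  have d32 := sub_ne_zero.2 h23.symm
  have d42 := sub_ne_zero.2 h24.symm
  obtain ⟨n, hn⟩ : ∃ n, n = (w₄ - w₁) * (w₃ - w₂) := ⟨_, rfl⟩
  obtain ⟨m, hm⟩ : ∃ m, m = (w₃ - w₁) * (w₄ - w₂) := ⟨_, rfl⟩
  have hn0 : n ≠ 0 := hn ▸ mul_ne_zero d41 d32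
  have hm0 : m ≠ 0 := hm ▸ mul_ne_zero d31 d42
  have hmn : m ≠ n := fun h => mul_ne_zero (sub_ne_zero.2 h12) (sub_ne_zero.2 h34)
    (by linear_combination h - hm + hn)
  obtain ⟨v, hv⟩ : ∃ v, v = (w₄ - w₁) / (w₄ - w₂) := ⟨_, rfl⟩
  have hv0 : v ≠ 0 := hv ▸ div_ne_zero d41 d42
  have hex (f : {f : RatFunc ℝ // GenericDegR 3 {w₁, w₂, w₃, w₄} f}) :
      ∃ s : ℝ, n * (s * (s + 2) ^ 3) = m * (2 * s + 1) ^ 3 ∧ HasNormalForm w₁ w₂ v s f := by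
    obtain ⟨s, hs, hf⟩ := f.2.exists_hasNormalForm h12 h13 h14 h23 h24 h34
    refine ⟨s, ?_, hv ▸ hf⟩
    field_simp at hs
    rw [hn, hm]
    linear_combination hs
  have huniq {f : RatFunc ℝ} {s t : ℝ} (hs : n * (s * (s + 2) ^ 3) = m * (2 * s + 1) ^ 3)
      (ht : n * (t * (t + 2) ^ 3) = m * (2 * t + 1) ^ 3) (hf : HasNormalForm w₁ w₂ v s f)
      (hf' : HasNormalForm w₁ w₂ v t f) : s = t := by
    obtain ⟨hs0, hs1, hs2, hs3⟩ := param_nondegenerate hm0 hn0 hmn hs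
    exact hf.param_unique h12 hv0 hs0 hs1 hs2 (param_nondegenerate hm0 hn0 hmn ht).2.2.1 hs3 hf'
  choose σ hσ hform using hex
  let φ : (Quot fun f g : {f : RatFunc ℝ // GenericDegR 3 {w₁, w₂, w₃, w₄} f} =>
      MobiusEquiv f.1 g.1) → {s : ℝ | n * (s * (s + 2) ^ 3) = m * (2 * s + 1) ^ 3} :=
    Quot.lift (fun f => ⟨σ f, hσ f⟩) fun f g hfg => by
      obtain ⟨L, hL, hg⟩ := mobiusEquiv_iff_exists_subst.1 hfg
      exact Subtype.ext (huniq (hσ f) (hσ g) (hg ▸ (hform f).subst hL) (hform g))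
  have hφ : Function.Bijective φ := by
    constructor
    · rintro ⟨f⟩ ⟨g⟩ hfg
      have hfg : σ f = σ g := congrArg Subtype.val hfg
      exact Quot.sound ((hform f).mobiusEquiv h12 (param_nondegenerate hm0 hn0 hmn (hσ f)).2.2.1
        (hfg ▸ hform g))
    · rintro ⟨s, hs⟩
      obtain ⟨hs0, hs1, hs2, -⟩ := param_nondegenerate hm0 hn0 hmn hs
      have hκ : -(-v / (2 * s + 1) ^ 3) * (2 * s + 1) ^ 3 = v := by field_simp
      have hs' : n * (s * (s + 2) ^ 3) = m * (2 * s + 1) ^ 3 := hs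
      obtain ⟨f, hf, hfs⟩ := exists_generic_hasNormalForm (w₃ := w₃) (w₄ := w₄)
        (κ := -v / (2 * s + 1) ^ 3) h12 (div_ne_zero (neg_ne_zero.2 hv0) (pow_ne_zero 3 hs2))
        hs0 hs1 (by
          rw [hn, hm] at hs'
          rw [hv]
          field_simp
          linear_combination hs') (by rw [hκ, hv]; field_simp)
      rw [hκ] at hfs
      exact ⟨Quot.mk _ ⟨f, hf⟩, Subtype.ext (huniq (hσ ⟨f, hf⟩) hs' (hform ⟨f, hf⟩) hfs)⟩
  rw [Nat.card_eq_of_bijective φ hφ, Nat.card_coe_set_eq, ncard_param_eq_two hn0]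
end
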